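/- arXiv:2201.06232 — 4 statements merged into one kernel-verified Lean document; each statement's English description precedes it below -/
import Mathlib

section
/- Let p be an odd prime, a₁, …, a_k distinct elements of 𝔽_p, ε₁, …, ε_k ∈ {1,-1}, and let N(ε₁,…,ε_k) be the number of c ∈ 𝔽_p with η(c + a_j) = ε_j for all j, where η is the quadratic character of 𝔽_p. Then |N(ε₁,…,ε_k) − p/2^k| ≤ ((k−2)/2 + 1/2^k)·√p + k/2. -/
open Polynomial Matrix

section generic
variable {F : Type*} [Field F]

lemma qc_taylor (φ : F[X]) (c : F) (n : ℕ) :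
    (X - C c) ^ n ∣ (∑ l : Fin n, (C c - X) ^ (l : ℕ) * hasseDeriv (l : ℕ) φ) - C (φ.eval c) := by
  rw [Fin.sum_univ_eq_sum_range (fun l => (C c - X) ^ l * hasseDeriv l φ) n]
  induction φ using Polynomial.induction_on' with
  | add f g hf hg =>
    have := dvd_add hf hg
    convert this using 1
    simp only [map_add, mul_add, Finset.sum_add_distrib, eval_add]
    ring
  | monomial m r =>
    have h1 : C ((monomial m r).eval c) =
        ∑ l ∈ Finset.range (n + m + 1), (C c - X) ^ l * hasseDeriv l (monomial m r) := by
      have h2 : ∑ l ∈ Finset.range (m + 1), (C c - X) ^ l * hasseDeriv l (monomial m r)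
        = ∑ l ∈ Finset.range (n + m + 1), (C c - X) ^ l * hasseDeriv l (monomial m r) := by
        apply Finset.sum_subset
        · intro x; simp only [Finset.mem_range]; omega
        · intro x _ hx
          have : m < x := by simp only [Finset.mem_range] at hx; omega
          rw [hasseDeriv_monomial, Nat.choose_eq_zero_of_lt this]; simp
      rw [← h2, eval_monomial, C_mul, C_pow]
      have h3 : (C c : F[X]) ^ m = ((C c - X) + X) ^ m := by ring
      rw [h3, add_pow, Finset.mul_sum]
      apply Finset.sum_congr rfl
      intro l _
      rw [hasseDeriv_monomial, ← C_mul_X_pow_eq_monomial, C_mul, C_eq_natCast]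
      ring
    rw [h1, show n + m + 1 = n + (m + 1) by ring, Finset.sum_range_add, sub_add_cancel_left,
      dvd_neg]
    apply Finset.dvd_sum
    intro l _
    rw [pow_add, ← neg_sub X (C c), neg_pow]
    exact ((Dvd.intro_left _ rfl).mul_right _).mul_right _

lemma qc_hasse_dvd (ρ : F) (m l : ℕ) (φ : F[X]) (h : (X - C ρ) ^ m ∣ φ) :
    (X - C ρ) ^ m ∣ (X - C ρ) ^ l * hasseDeriv l φ := by
  induction m generalizing l φ with
  | zero => simp
  | succ m ih =>
    obtain ⟨q, rfl⟩ := h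
    cases l with
    | zero => simp
    | succ l =>
      have h1 : hasseDeriv (l + 1) ((X - C ρ) ^ (m + 1) * q) =
          (X - C ρ) * hasseDeriv (l + 1) ((X - C ρ) ^ m * q) +
            hasseDeriv l ((X - C ρ) ^ m * q) := by
        rw [pow_succ', mul_assoc, hasseDeriv_mul, Finset.Nat.antidiagonal_succ,
          Finset.sum_cons, Finset.sum_map]
        cases l with
        | zero => simp [hasseDeriv_one]
        | succ l =>
          rw [Finset.Nat.antidiagonal_succ, Finset.sum_cons, Finset.sum_map]
          simp only [hasseDeriv_zero, Function.Embedding.prodMap, Function.Embedding.coeFn_mk,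
            Prod.map, Function.Embedding.refl_apply, map_sub, Nat.succ_eq_add_one]
          rw [Finset.sum_eq_zero]
          · simp [hasseDeriv_one]
          · intro x _
            rw [hasseDeriv_X _ (by omega), hasseDeriv_C _ _ (by omega)]; simp
      rw [h1, mul_add]
      apply dvd_add
      · rw [← mul_assoc, mul_comm _ (X - C ρ), mul_assoc, pow_succ']
        exact mul_dvd_mul_left _ (ih _ _ (Dvd.intro _ rfl))
      · rw [pow_succ' _ l, mul_assoc, pow_succ']
        exact mul_dvd_mul_left _ (ih _ _ (Dvd.intro _ rfl))

variable {ι : Type*} [Fintype ι] [DecidableEq ι]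

/-- Frobenius-Wronskian matrix -/
noncomputable def qcM {n : ℕ} (r : ι ≃ Fin (n + 1)) (φ ψ : ι → F[X]) : Matrix ι ι F[X] :=
  Matrix.of fun i j => Fin.cases (motive := fun _ => F[X]) (ψ j)
    (fun l : Fin n => hasseDeriv (l : ℕ) (φ j)) (r i)

lemma qc_point {n : ℕ} (r : ι ≃ Fin (n + 1)) (φ ψ : ι → F[X]) (c : F)
    (h : ∀ j, (X - C c) ^ n ∣ ψ j - C ((φ j).eval c)) :
    (X - C c) ^ n ∣ (qcM r φ ψ).det := by
  let w : Fin (n + 1) → F[X] := Fin.cons (-1) (fun l : Fin n => (C c - X) ^ (l : ℕ))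
  let v : ι → F[X] := fun i => w (r i)
  have hv : v (r.symm 0) = -1 := by simp [v, w]
  have h1 : ∀ j, (X - C c) ^ n ∣ (v ᵥ* qcM r φ ψ) j := by
    intro j
    have : (v ᵥ* qcM r φ ψ) j =
        ((∑ l : Fin n, (C c - X) ^ (l : ℕ) * hasseDeriv (l : ℕ) (φ j)) - C ((φ j).eval c))
        - (ψ j - C ((φ j).eval c)) := by
      simp only [vecMul, dotProduct, v, qcM, of_apply]
      rw [Equiv.sum_comp r (fun i => w i * Fin.cases (motive := fun _ => F[X]) (ψ j)
        (fun l : Fin n => hasseDeriv (l : ℕ) (φ j)) i), Fin.sum_univ_succ]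
      simp [w]; ring
    rw [this]
    exact dvd_sub (qc_taylor _ _ _) (h j)
  have h2 : -(qcM r φ ψ).det = ((v ᵥ* qcM r φ ψ) ᵥ* (qcM r φ ψ).adjugate) (r.symm 0) := by
    rw [vecMul_vecMul, mul_adjugate, vecMul_smul, vecMul_one, Pi.smul_apply, hv]; simp
  rw [← dvd_neg, h2]
  simp only [vecMul, dotProduct]
  exact Finset.dvd_sum fun j _ => (h1 j).mul_right _

lemma qc_det_col_dvd (M : Matrix ι ι F[X]) (u : F[X]) (e : ι → ℕ)
    (h : ∀ i j, u ^ e j ∣ M i j) : u ^ (∑ j, e j) ∣ M.det := by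
  rw [det_apply]
  apply Finset.dvd_sum
  intro σ _
  apply dvd_smul_of_dvd
  rw [← Finset.prod_pow_eq_pow_sum]
  exact Finset.prod_dvd_prod_of_dvd _ _ fun i _ => h _ _

/-- row weights -/
def qcW {n : ℕ} (i : Fin (n + 1)) : ℕ := Fin.cases (motive := fun _ => ℕ) 0 (fun l : Fin n => l) i

lemma qcW_sum {n : ℕ} (r : ι ≃ Fin (n + 1)) : ∑ i, qcW (r i) = ∑ l ∈ Finset.range n, l := by
  rw [Equiv.sum_comp r (fun i => qcW i), Fin.sum_univ_succ]
  simp [qcW, Finset.sum_range]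

lemma qc_scale {n : ℕ} (r : ι ≃ Fin (n + 1)) (M : Matrix ι ι F[X]) (u : F[X]) :
    (Matrix.of fun i j => u ^ qcW (r i) * M i j).det = u ^ (∑ l ∈ Finset.range n, l) * M.det := by
  rw [det_mul_column (fun i => u ^ qcW (r i)) M, Finset.prod_pow_eq_pow_sum, qcW_sum]

lemma qc_root {n : ℕ} (r : ι ≃ Fin (n + 1)) (φ ψ φ' ψ' : ι → F[X]) (ρ : F) (e : ι → ℕ)
    (A : Matrix ι ι F) (hφ : ∀ j, φ j = ∑ k, φ' k * C (A k j))
    (hψ : ∀ j, ψ j = ∑ k, ψ' k * C (A k j))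
    (h1 : ∀ k, (X - C ρ) ^ e k ∣ φ' k) (h2 : ∀ k, (X - C ρ) ^ e k ∣ ψ' k) :
    (X - C ρ) ^ (∑ k, e k) ∣ (X - C ρ) ^ (∑ l ∈ Finset.range n, l) * (qcM r φ ψ).det := by
  have hM : qcM r φ ψ = qcM r φ' ψ' * A.map C := by
    ext1 i j
    simp only [qcM, of_apply, mul_apply, map_apply]
    induction r i using Fin.cases with
    | zero => simp [hψ]
    | succ l =>
      simp only [Fin.cases_succ, hφ, map_sum]
      refine Finset.sum_congr rfl fun k _ => ?_
      rw [mul_comm, ← smul_eq_C_mul, map_smul, smul_eq_C_mul, mul_comm]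
  rw [hM, det_mul, ← mul_assoc, ← qc_scale r]
  apply Dvd.dvd.mul_right
  apply qc_det_col_dvd
  intro i j
  simp only [qcM, of_apply, qcW]
  induction r i using Fin.cases with
  | zero => simpa using h2 j
  | succ l => simpa using qc_hasse_dvd _ _ _ _ (h1 j)

lemma qc_coeff_prod {κ : Type*} (s : Finset κ) (f : κ → F[X]) (e : κ → ℕ)
    (h : ∀ i ∈ s, (f i).natDegree ≤ e i) :
    (∏ i ∈ s, f i).natDegree ≤ ∑ i ∈ s, e i ∧
    (∏ i ∈ s, f i).coeff (∑ i ∈ s, e i) = ∏ i ∈ s, (f i).coeff (e i) := by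
  classical
  induction s using Finset.induction_on with
  | empty => simp
  | insert a s ha ih =>
    have ih' := ih fun i hi => h i (Finset.mem_insert_of_mem hi)
    have h0 := h a (Finset.mem_insert_self _ _)
    rw [Finset.prod_insert ha, Finset.sum_insert ha, Finset.prod_insert ha, ← ih'.2]
    exact ⟨natDegree_mul_le_of_le h0 ih'.1, coeff_mul_add_eq_of_natDegree_le h0 ih'.1⟩

lemma qc_det_coeff (M : Matrix ι ι F[X]) (s e : ι → ℕ)
    (h : ∀ i j, (M i j).natDegree ≤ s i + e j) :
    M.det.natDegree ≤ ∑ i, s i + ∑ i, e i ∧ 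
    M.det.coeff (∑ i, s i + ∑ i, e i) = (Matrix.of fun i j => (M i j).coeff (s i + e j)).det := by
  have key : ∀ σ : Equiv.Perm ι, (∏ i, M (σ i) i).natDegree ≤ ∑ i, s i + ∑ i, e i ∧
     (∏ i, M (σ i) i).coeff (∑ i, s i + ∑ i, e i) = ∏ i, (M (σ i) i).coeff (s (σ i) + e i) := by
    intro σ
    have := qc_coeff_prod Finset.univ (fun i => M (σ i) i) (fun i => s (σ i) + e i)
      (fun i _ => h _ _)
    rwa [Finset.sum_add_distrib, Equiv.sum_comp σ s] at this
  constructor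
  · rw [det_apply]
    apply natDegree_sum_le_of_forall_le
    intro σ _
    exact (natDegree_smul_le _ _).trans (key σ).1
  · rw [det_apply, det_apply, finsetSum_coeff]
    refine Finset.sum_congr rfl fun σ _ => ?_
    rw [coeff_smul, (key σ).2]; rfl


lemma qc_choose_det {n : ℕ} (v : Fin n → ℕ) (hv : Function.Injective fun i => (v i : F)) :
    (Matrix.of fun l j : Fin n => ((Nat.choose (v j) l : ℕ) : F)).det ≠ 0 := by
  intro h0
  have h := det_eval_matrixOfPolynomials_eq_det_vandermonde (fun i => (v i : F))
      (fun i => descPochhammer F i)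
      (fun i => descPochhammer_natDegree F i)
      (fun i => monic_descPochhammer F i)
  have h2 : (Matrix.of (fun i j : Fin n => ((descPochhammer F j).eval (v i : F)))).det =
     (∏ i : Fin n, (Nat.factorial i : F)) *
      (Matrix.of fun i j : Fin n => ((Nat.choose (v i) j : ℕ) : F)).det := by
    rw [← det_mul_row]
    congr 1
    ext i j
    rw [of_apply, of_apply, descPochhammer_eval_eq_descFactorial, of_apply,
      Nat.descFactorial_eq_factorial_mul_choose, Nat.cast_mul]
  have h3 : (Matrix.of fun i j : Fin n => ((Nat.choose (v i) j : ℕ) : F)).det = 0 := by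
    rw [← h0, ← det_transpose]; rfl
  rw [h2, h3, mul_zero] at h
  exact det_vandermonde_ne_zero_iff.mpr hv h

lemma qc_deg {n : ℕ} (r : ι ≃ Fin (n + 1)) (φ ψ : ι → F[X]) (e : ι → ℕ) (s0 : ℕ) (j0 : ι)
    (hφ : ∀ j, (φ j).Monic) (he : ∀ j, (φ j).natDegree = e j)
    (hj0 : (ψ j0).Monic) (hj0' : (ψ j0).natDegree = s0 + e j0)
    (hψ : ∀ j, j ≠ j0 → (ψ j).natDegree < s0 + e j)
    (hinj : Function.Injective fun j => (e j : F)) :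
    (qcM r φ ψ).det ≠ 0 ∧
      (∑ l ∈ Finset.range n, l) + (qcM r φ ψ).det.natDegree ≤ s0 + ∑ j, e j := by
  let s : ι → ℕ := fun i => Fin.cases (motive := fun _ => ℕ) s0 (fun _ : Fin n => 0) (r i)
  have hs : ∑ i, s i = s0 := by
    simp only [s]
    rw [Equiv.sum_comp r (fun i => Fin.cases (motive := fun _ => ℕ) s0 (fun _ : Fin n => 0) i),
      Fin.sum_univ_succ]
    simp
  let M' : Matrix ι ι F[X] := Matrix.of fun i j => X ^ qcW (r i) * qcM r φ ψ i j
  let K : Fin (n + 1) → ι → F := fun i j => Fin.cases (motive := fun _ => F)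
     (if j = j0 then 1 else 0) (fun l : Fin n => ((Nat.choose (e j) l : ℕ) : F)) i
  have hdegs : ∀ i j, (M' i j).natDegree ≤ s i + e j ∧ (M' i j).coeff (s i + e j) = K (r i) j := by
    intro i j
    simp only [M', s, K, qcM, of_apply, qcW]
    induction r i using Fin.cases with
    | zero =>
      simp only [Fin.cases_zero, pow_zero, one_mul]
      by_cases h : j = j0
      · subst h
        refine ⟨hj0'.le, ?_⟩
        rw [← hj0', if_pos rfl]; exact hj0
      · rw [if_neg h]
        exact ⟨(hψ j h).le, coeff_eq_zero_of_natDegree_lt (hψ j h)⟩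
    | succ l =>
      simp only [Fin.cases_succ, zero_add]
      have hc : ∀ m, (X ^ (l : ℕ) * hasseDeriv (l : ℕ) (φ j)).coeff m =
          ((Nat.choose m l : ℕ) : F) * (φ j).coeff m := by
        intro m
        rw [coeff_X_pow_mul']
        split_ifs with h
        · rw [hasseDeriv_coeff, Nat.sub_add_cancel h]
        · rw [Nat.choose_eq_zero_of_lt (by omega)]; simp
      constructor
      · rw [natDegree_le_iff_coeff_eq_zero]
        intro m hm
        rw [hc, coeff_eq_zero_of_natDegree_lt (by rw [he]; exact hm), mul_zero]
      · rw [hc, ← he, show (φ j).coeff (φ j).natDegree = 1 from hφ j, mul_one]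
  have hdet := qc_det_coeff M' s e fun i j => (hdegs i j).1
  have hK : (Matrix.of fun i j => (M' i j).coeff (s i + e j)).det ≠ 0 := by
    have : (Matrix.of fun i j => (M' i j).coeff (s i + e j)) = Matrix.of fun i j => K (r i) j := by
      ext i j; exact (hdegs i j).2
    rw [this, ← det_submatrix_equiv_self r.symm, det_succ_row _ 0,
      Finset.sum_eq_single (r j0)]
    · apply mul_ne_zero
      · simp [K]
      · have := qc_choose_det (F := F) (n := n)
          (fun i => e (r.symm ((r j0).succAbove i)))
          (hinj.comp (r.symm.injective.comp Fin.succAbove_right_injective))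
        convert this using 2
        ext l j
        simp [K, submatrix]
    · intro b _ hb
      have : r.symm b ≠ j0 := by rintro rfl; simp at hb
      simp [K, this]
    · simp
  rw [← hdet.2, hs] at hK
  rw [hs] at hdet
  have hsc : M'.det = X ^ (∑ l ∈ Finset.range n, l) * (qcM r φ ψ).det := qc_scale r _ _
  have hne : (qcM r φ ψ).det ≠ 0 := by
    intro h
    rw [hsc, h] at hK; simp at hK
  refine ⟨hne, ?_⟩
  have h1 := hdet.1
  rw [hsc, natDegree_mul (pow_ne_zero _ X_ne_zero) hne, natDegree_X_pow] at h1
  exact h1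

end generic

lemma qc_range_sum (n : ℕ) : 2 * ((∑ l ∈ Finset.range n, l : ℕ) : ℤ) = n * (n - 1) := by
  induction n with
  | zero => simp
  | succ n ih => rw [Finset.sum_range_succ]; push_cast at ih ⊢; linarith

lemma qc_binom {F : Type*} [Field F] (ρ : F) (m : ℕ) (i : Fin m) :
    (X : F[X]) ^ (i : ℕ) =
      ∑ k : Fin m, (X - C ρ) ^ (k : ℕ) * C (ρ ^ ((i : ℕ) - k) * ((i : ℕ).choose k : ℕ)) := by
  rw [Fin.sum_univ_eq_sum_range
    (fun k => (X - C ρ) ^ k * C (ρ ^ ((i : ℕ) - k) * ((i : ℕ).choose k : ℕ))) m]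
  have h1 : (X : F[X]) ^ (i : ℕ) = ((X - C ρ) + C ρ) ^ (i : ℕ) := by ring
  rw [h1, add_pow]
  have h2 : ∑ k ∈ Finset.range ((i : ℕ) + 1),
      (X - C ρ) ^ k * C (ρ ^ ((i : ℕ) - k) * ((i : ℕ).choose k : ℕ)) =
      ∑ k ∈ Finset.range m, (X - C ρ) ^ k * C (ρ ^ ((i : ℕ) - k) * ((i : ℕ).choose k : ℕ)) := by
    apply Finset.sum_subset
    · intro x; simp only [Finset.mem_range]; omega
    · intro x _ hx
      have : (i : ℕ) < x := by simp only [Finset.mem_range] at hx; omega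
      rw [Nat.choose_eq_zero_of_lt this]; simp
  rw [← h2]
  refine Finset.sum_congr rfl fun k _ => ?_
  rw [C_mul, C_pow, map_natCast, mul_assoc]

lemma qc_count {F : Type*} [Field F] [Fintype F] [DecidableEq F] (D : F[X]) (hD : D ≠ 0)
    (S R : Finset F) (hSR : Disjoint S R) (n m : ℕ)
    (hS : ∀ c ∈ S, (X - C c) ^ n ∣ D) (hR : ∀ c ∈ R, (X - C c) ^ m ∣ D) :
    S.card * n + R.card * m ≤ D.natDegree := by
  let E : F → ℕ := fun c => if c ∈ S then n else m
  have h : ∏ c ∈ S ∪ R, (X - C c) ^ E c ∣ D := by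
    apply Finset.prod_dvd_of_coprime
    · intro c _ c' _ hcc
      exact (isCoprime_X_sub_C_of_isUnit_sub
        (sub_ne_zero.mpr hcc).isUnit).pow
    · intro c hc
      by_cases h : c ∈ S
      · simpa [E, h] using hS c h
      · have : c ∈ R := by simpa [h] using hc
        simpa [E, h] using hR c this
  have h2 := natDegree_le_of_dvd h hD
  rw [natDegree_prod_of_monic _ _ fun c _ => (monic_X_sub_C c).pow _] at h2
  simp only [natDegree_pow, natDegree_X_sub_C, mul_one] at h2
  rw [Finset.sum_union hSR, Finset.sum_congr rfl (g := fun _ => n) (fun c hc => by simp [E, hc]),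
    Finset.sum_congr rfl (s₁ := R) (g := fun _ => m)
      (fun c hc => by simp [E, Finset.disjoint_right.mp hSR hc])] at h2
  simpa using h2

theorem qc_core (p : ℕ) [Fact p.Prime] (R : Finset (ZMod p)) (g b h : ℕ) (hp : p + 1 = 2 * h)
    (hR : R.card = 2 * g + 1) (hb : 1 ≤ b) (hab : 2 * (b + g) ≤ p)
    (ε : ZMod p) (hε : ε = 1 ∨ ε = -1) (S : Finset (ZMod p))
    (hS : ∀ c ∈ S, (∏ ρ ∈ R, (c - ρ)) ^ (h - 1) = ε) :
    ((2 * b + g : ℕ) : ℤ) * S.card ≤ (b + g) * (p - b + (2 * g + 1) * (b - 1)) := by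
  obtain ⟨a, ha⟩ : ∃ a, a = b + g := ⟨_, rfl⟩
  obtain ⟨d, hd⟩ : ∃ d, d = 2 * g + 1 := ⟨_, rfl⟩
  have hp2 := (Fact.out : p.Prime).two_le
  have hh : 2 ≤ h := by omega
  have hε0 : ε ≠ 0 := by rcases hε with h | h <;> simp [h]
  set f : (ZMod p)[X] := ∏ ρ ∈ R, (X - C ρ) with hf
  have hfm : f.Monic := monic_prod_of_monic _ _ fun c _ => monic_X_sub_C c
  have hfd : f.natDegree = d := by
    rw [hf, natDegree_prod_of_monic _ _ fun c _ => monic_X_sub_C c]; simp [hR, hd]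
  have hfe : ∀ c, f.eval c = ∏ ρ ∈ R, (c - ρ) := by intro c; simp [hf, eval_prod]
  let r : (Fin (a + 1) ⊕ Fin b) ≃ Fin (a + b + 1) :=
    finSumFinEquiv.trans (finCongr (by ring))
  let φ : (Fin (a + 1) ⊕ Fin b) → (ZMod p)[X] :=
    Sum.elim (fun i => X ^ (i : ℕ)) (fun i => f ^ h * X ^ (i : ℕ))
  let q : (Fin (a + 1) ⊕ Fin b) → (ZMod p)[X] :=
    Sum.elim (fun i => X ^ (i : ℕ)) (fun i => C ε * f * X ^ (i : ℕ))
  let ψ : (Fin (a + 1) ⊕ Fin b) → (ZMod p)[X] := fun j => expand (ZMod p) p (q j)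
  let e : (Fin (a + 1) ⊕ Fin b) → ℕ := Sum.elim (fun i => (i : ℕ)) (fun i => d * h + i)
  -- nonvanishing and degree
  have h1 := qc_deg r φ ψ e ((p - 1) * a) (Sum.inl (Fin.last a))
    (by
      rintro (i | i)
      · exact monic_X_pow _
      · exact (hfm.pow _).mul (monic_X_pow _))
    (by
      rintro (i | i)
      · simp [φ, e]
      · simp only [φ, e, Sum.elim_inr]
        rw [(hfm.pow _).natDegree_mul (monic_X_pow _), natDegree_pow, natDegree_X_pow, hfd]
        ring)
    (by
      simp only [ψ, q, Sum.elim_inl]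
      exact (monic_X_pow _).expand (by omega))
    (by
      simp only [ψ, q, e, Sum.elim_inl, natDegree_expand, natDegree_X_pow, Fin.val_last]
      obtain ⟨p', rfl⟩ : ∃ p', p = p' + 1 := ⟨p - 1, by omega⟩
      simp; ring)
    (by
      obtain ⟨h', rfl⟩ : ∃ h', h = h' + 2 := ⟨h - 2, by omega⟩
      have hp' : p = 2 * h' + 3 := by omega
      rintro (i | i) hi
      · simp only [ψ, q, e, Sum.elim_inl, natDegree_expand, natDegree_X_pow]
        have : (i : ℕ) < a := by
          have := i.2
          have h3 : (i : ℕ) ≠ a := by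
            intro h; apply hi; congr 1; ext; simpa using h
          omega
        have h4 : p - 1 = 2 * h' + 2 := by omega
        rw [h4, hp']
        nlinarith
      · simp only [ψ, q, e, Sum.elim_inr, natDegree_expand]
        rw [mul_assoc, natDegree_C_mul hε0, hfm.natDegree_mul (monic_X_pow _), natDegree_X_pow,
          hfd]
        have h4 : p - 1 = 2 * h' + 2 := by omega
        have h5 := i.2
        rw [h4, hp']
        have h6 : d + 2 * i + 1 ≤ 2 * a := by omega
        nlinarith)
    (by
      have h2h : (2 : ZMod p) * h = 1 := by
        have : ((p + 1 : ℕ) : ZMod p) = ((2 * h : ℕ) : ZMod p) := by rw [hp]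
        push_cast at this
        simpa using this.symm
      have hcast : ∀ x y : ℕ, x < p → y < p → (x : ZMod p) = y → x = y := by
        intro x y hx hy hxy
        rw [ZMod.natCast_eq_natCast_iff'] at hxy
        rwa [Nat.mod_eq_of_lt hx, Nat.mod_eq_of_lt hy] at hxy
      have hmix : ∀ (i : Fin (a + 1)) (j : Fin b), ((i : ℕ) : ZMod p) ≠ ((d * h + j : ℕ) : ZMod p) := by
        intro i j hij
        have := hcast (2 * i) (d + 2 * j) (by omega) (by omega) (by
          push_cast at hij ⊢
          rw [hij]; linear_combination (d : ZMod p) * h2h)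
        omega
      rintro (i | i) (j | j) hij
      · have := hcast i j (by omega) (by omega) hij
        congr 1; ext; exact this
      · exact absurd hij (hmix i j)
      · exact absurd hij.symm (hmix j i)
      · have := hcast i j (by omega) (by omega) (by
          simp only [e, Sum.elim_inr] at hij
          push_cast at hij
          simpa using hij)
        congr 1; ext; exact this)
  obtain ⟨hne, hdeg⟩ := h1
  -- points
  have hpt : ∀ c ∈ S, (X - C c) ^ (a + b) ∣ (qcM r φ ψ).det := by
    intro c hc
    apply qc_point
    intro j
    have h3 : (φ j).eval c = (q j).eval c := by
      rcases j with i | i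
      · rfl
      · simp only [φ, q, Sum.elim_inr, eval_mul, eval_pow, eval_X, eval_C]
        rw [← hS c hc, hfe, ← pow_succ, Nat.sub_add_cancel (by omega)]
    have h4 : X - C c ∣ q j - C ((q j).eval c) := X_sub_C_dvd_sub_C_eval
    rw [h3]
    have h5 : ψ j - C ((q j).eval c) = (q j - C ((q j).eval c)) ^ p := by
      rw [← ZMod.expand_card]; simp [ψ]
    rw [h5]
    exact (pow_dvd_pow _ (by omega)).trans (pow_dvd_pow_of_dvd h4 p)
  -- roots
  let e' : (Fin (a + 1) ⊕ Fin b) → ℕ := Sum.elim (fun i => (i : ℕ)) (fun i => h + i)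
  have hrt : ∀ ρ ∈ R, (X - C ρ) ^ (∑ k, e' k) ∣
      (X - C ρ) ^ (∑ l ∈ Finset.range (a + b), l) * (qcM r φ ψ).det := by
    intro ρ hρ
    have hfρ : X - C ρ ∣ f := Finset.dvd_prod_of_mem _ hρ
    let B : ∀ m : ℕ, Matrix (Fin m) (Fin m) (ZMod p) :=
      fun m => Matrix.of fun k i => ρ ^ ((i : ℕ) - k) * ((i : ℕ).choose k : ℕ)
    let q' : (Fin (a + 1) ⊕ Fin b) → (ZMod p)[X] :=
      Sum.elim (fun i => (X - C ρ) ^ (i : ℕ)) (fun i => C ε * f * (X - C ρ) ^ (i : ℕ))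
    refine qc_root r φ ψ
      (Sum.elim (fun i => (X - C ρ) ^ (i : ℕ)) (fun i => f ^ h * (X - C ρ) ^ (i : ℕ)))
      (fun j => expand (ZMod p) p (q' j)) ρ e' (fromBlocks (B (a + 1)) 0 0 (B b)) ?_ ?_ ?_ ?_
    · rintro (i | i)
      · simp only [φ, Sum.elim_inl, Fintype.sum_sum_type, fromBlocks_apply₁₁, fromBlocks_apply₂₁,
          Sum.elim_inr, Matrix.zero_apply, map_zero, mul_zero, Finset.sum_const_zero, add_zero]
        exact qc_binom ρ (a + 1) i
      · simp only [φ, Sum.elim_inl, Fintype.sum_sum_type, fromBlocks_apply₁₂, fromBlocks_apply₂₂,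
          Sum.elim_inr, Matrix.zero_apply, map_zero, mul_zero, Finset.sum_const_zero, zero_add]
        rw [qc_binom ρ b i, Finset.mul_sum]
        simp only [mul_assoc]; rfl
    · have hq : ∀ j, q j = ∑ k, q' k * C (fromBlocks (B (a + 1)) 0 0 (B b) k j) := by
        rintro (i | i)
        · simp only [q, q', Sum.elim_inl, Fintype.sum_sum_type, fromBlocks_apply₁₁,
            fromBlocks_apply₂₁,
            Sum.elim_inr, Matrix.zero_apply, map_zero, mul_zero, Finset.sum_const_zero, add_zero]
          exact qc_binom ρ (a + 1) i
        · simp only [q, q', Sum.elim_inl, Fintype.sum_sum_type, fromBlocks_apply₁₂,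
            fromBlocks_apply₂₂,
            Sum.elim_inr, Matrix.zero_apply, map_zero, mul_zero, Finset.sum_const_zero, zero_add]
          rw [qc_binom ρ b i, Finset.mul_sum]
          simp only [mul_assoc]; rfl
      intro j
      simp only [ψ]
      rw [hq j, map_sum]
      simp only [map_mul, expand_C]
    · rintro (i | i)
      · exact dvd_rfl
      · simp only [e', Sum.elim_inr, pow_add]
        exact mul_dvd_mul_right (pow_dvd_pow_of_dvd hfρ h) _
    · rintro (i | i)
      · simp only [e', q', Sum.elim_inl, ZMod.expand_card, ← pow_mul]
        exact pow_dvd_pow _ (Nat.le_mul_of_pos_right _ (by omega))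
      · simp only [e', q', Sum.elim_inr, ZMod.expand_card, mul_pow, ← pow_mul, pow_add]
        apply mul_dvd_mul
        · exact ((pow_dvd_pow _ (by omega)).trans (pow_dvd_pow_of_dvd hfρ p)).mul_left _
        · exact pow_dvd_pow _ (Nat.le_mul_of_pos_right _ (by omega))
  have se : ∑ j, e j = (∑ l ∈ Finset.range (a + 1), l) + b * (d * h) + ∑ l ∈ Finset.range b, l := by
    simp [e, Fintype.sum_sum_type, Finset.sum_add_distrib, Finset.sum_range, add_assoc]
  have se' : ∑ j, e' j = (∑ l ∈ Finset.range (a + 1), l) + b * h + ∑ l ∈ Finset.range b, l := by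
    simp [e', Fintype.sum_sum_type, Finset.sum_add_distrib, Finset.sum_range, add_assoc]
  have G1 := qc_range_sum (a + 1)
  have G2 := qc_range_sum b
  have G3 := qc_range_sum (a + b)
  rw [se] at hdeg
  rw [se'] at hrt
  generalize (∑ l ∈ Finset.range (a + 1), l) = g1 at *
  generalize (∑ l ∈ Finset.range b, l) = g2 at *
  generalize (∑ l ∈ Finset.range (a + b), l) = g3 at *
  have hle : g3 ≤ g1 + b * h + g2 := by
    zify; push_cast at G1 G2 G3
    have : (a : ℤ) ≤ h := by omega
    nlinarith
  obtain ⟨m, hm⟩ := Nat.exists_eq_add_of_le hle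
  have hrt' : ∀ ρ ∈ R, (X - C ρ) ^ m ∣ (qcM r φ ψ).det := by
    intro ρ hρ
    have := hrt ρ hρ
    rw [hm, pow_add] at this
    exact (mul_dvd_mul_iff_left (pow_ne_zero _ (X_sub_C_ne_zero ρ))).mp this
  have hdisj : Disjoint S R := by
    rw [Finset.disjoint_left]
    intro c hc hcR
    have := hS c hc
    rw [Finset.prod_eq_zero hcR (sub_self c), zero_pow (by omega)] at this
    exact hε0 this.symm
  have hfin := qc_count _ hne S R hdisj _ _ hpt hrt'
  rw [hR, ← hd] at hfin
  have hp1 : ((p - 1 : ℕ) : ℤ) = 2 * h - 2 := by omega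
  have hpz : (p : ℤ) = 2 * h - 1 := by omega
  zify at hfin hdeg hm ha hd
  rw [hp1] at hdeg
  push_cast at G1 G2 G3 ⊢
  rw [hpz]
  have hmz : (m : ℤ) = b * h - a * b + a := by linarith
  rw [hmz] at hfin
  have key : (a + b : ℤ) * S.card ≤ a * (2 * h - 1 - b + d * (b - 1)) := by linarith
  rw [ha, hd] at key
  linarith

lemma qc_weil_odd (p : ℕ) [Fact p.Prime] (hodd : Odd p) (R : Finset (ZMod p)) (g : ℕ)
    (hR : R.card = 2 * g + 1) :
    |((∑ c : ZMod p, quadraticChar (ZMod p) (∏ ρ ∈ R, (c - ρ)) : ℤ) : ℝ)| ≤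
      2 * g * Real.sqrt p := by
  have hp2 := (Fact.out : p.Prime).two_le
  have hchar : ringChar (ZMod p) ≠ 2 := by
    rw [ZMod.ringChar_zmod_n]; rintro rfl; revert hodd; decide
  set P : ZMod p → ZMod p := fun c => ∏ ρ ∈ R, (c - ρ) with hP
  have hP0 : ∀ c, P c = 0 ↔ c ∈ R := by
    intro c
    simp only [hP, Finset.prod_eq_zero_iff, sub_eq_zero]
    exact ⟨fun ⟨x, hx, h⟩ => h ▸ hx, fun h => ⟨c, h, rfl⟩⟩
  set S1 := Finset.univ.filter fun c => quadraticChar (ZMod p) (P c) = 1 with hS1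
  set S2 := Finset.univ.filter fun c => quadraticChar (ZMod p) (P c) = -1 with hS2
  have hval : ∀ c, quadraticChar (ZMod p) (P c) =
      (if quadraticChar (ZMod p) (P c) = 1 then 1 else 0) -
      (if quadraticChar (ZMod p) (P c) = -1 then 1 else 0) := by
    intro c
    by_cases h : P c = 0
    · rw [h, quadraticChar_zero]; decide
    · rcases quadraticChar_dichotomy h with h | h <;> rw [h] <;> decide
  have hone : ∀ c, (1 : ℤ) =
      (if quadraticChar (ZMod p) (P c) = 1 then 1 else 0) +
      (if quadraticChar (ZMod p) (P c) = -1 then 1 else 0) + (if c ∈ R then 1 else 0) := by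
    intro c
    by_cases h : P c = 0
    · rw [h, quadraticChar_zero, if_neg (by decide), if_neg (by decide), if_pos ((hP0 c).1 h)]
      rfl
    · have h' := mt (hP0 c).2 h
      rw [if_neg h']
      rcases quadraticChar_dichotomy h with h | h <;> rw [h] <;> decide
  have hsum : (∑ c : ZMod p, quadraticChar (ZMod p) (P c)) = (S1.card : ℤ) - S2.card := by
    rw [Finset.sum_congr rfl fun c _ => hval c, Finset.sum_sub_distrib, Finset.sum_boole,
      Finset.sum_boole]
  have htot : (p : ℤ) = S1.card + S2.card + (2 * g + 1) := by
    have h1 : (∑ _c : ZMod p, (1 : ℤ)) = p := by simp [ZMod.card]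
    rw [← h1, Finset.sum_congr rfl fun c _ => hone c, Finset.sum_add_distrib,
      Finset.sum_add_distrib, Finset.sum_boole, Finset.sum_boole, Finset.sum_boole]
    congr 1
    simp [hR]
  change |((∑ c : ZMod p, quadraticChar (ZMod p) (P c) : ℤ) : ℝ)| ≤ _
  rw [hsum]
  have hsq : Real.sqrt p * Real.sqrt p = p := Real.mul_self_sqrt (Nat.cast_nonneg p)
  have hs0 := Real.sqrt_nonneg (p : ℝ)
  have htotR : (p : ℝ) = S1.card + S2.card + (2 * g + 1) := by exact_mod_cast htot
  push_cast
  by_cases hsmall : Nat.sqrt p < 2 * g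
  · have h1 : Real.sqrt p ≤ 2 * g := by
      apply Real.sqrt_le_iff.mpr
      refine ⟨by positivity, ?_⟩
      have h2 := Nat.sqrt_lt.mp hsmall
      have h3 : (p : ℝ) < (2 * g) * (2 * g) := by exact_mod_cast h2
      nlinarith
    have h4 : (p : ℝ) ≤ 2 * g * Real.sqrt p := by nlinarith
    have : (0 : ℝ) ≤ S1.card := Nat.cast_nonneg _
    have : (0 : ℝ) ≤ S2.card := Nat.cast_nonneg _
    have : (0 : ℝ) ≤ g := by positivity
    rw [abs_le]; constructor <;> linarith
  · push Not at hsmall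
    set s := Nat.sqrt p with hs
    have hs1 : s * s ≤ p := Nat.sqrt_le p
    obtain ⟨h, hh⟩ : ∃ h, p + 1 = 2 * h := by
      obtain ⟨t, ht⟩ := hodd; exact ⟨t + 1, by omega⟩
    have hspos : 1 ≤ s := Nat.le_sqrt.mpr (by omega)
    have hs2 : p < (s + 1) * (s + 1) := Nat.lt_succ_sqrt p
    set b := (s + 1) / 2 with hb
    have hb1 : 1 ≤ b := by omega
    have hb2 : s ≤ 2 * b := by omega
    have hb3 : 2 * b ≤ s + 1 := by omega
    have hab : 2 * (b + g) ≤ p := by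
      have h2 : 2 * (b + g) ≤ 2 * s + 1 := by omega
      rcases Nat.lt_or_ge s 3 with h3 | h3
      · interval_cases s <;> omega
      · nlinarith
    have hhalf : p / 2 = h - 1 := by omega
    have hpow : ∀ c, quadraticChar (ZMod p) (P c) ≠ 0 →
        ((quadraticChar (ZMod p) (P c) : ℤ) : ZMod p) = P c ^ (h - 1) := by
      intro c _
      rw [quadraticChar_eq_pow_of_char_ne_two' hchar, ZMod.card, hhalf]
    have c1 := qc_core p R g b h hh hR hb1 hab 1 (Or.inl rfl) S1 (by
      intro c hc
      have hc' : quadraticChar (ZMod p) (P c) = 1 := by simpa [hS1] using hc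
      have := hpow c (by rw [hc']; decide)
      rw [hc'] at this
      simpa using this.symm)
    have c2 := qc_core p R g b h hh hR hb1 hab (-1) (Or.inr rfl) S2 (by
      intro c hc
      have hc' : quadraticChar (ZMod p) (P c) = -1 := by simpa [hS2] using hc
      have := hpow c (by rw [hc']; decide)
      rw [hc'] at this
      simpa using this.symm)
    have c1R : ((2 * b + g : ℕ) : ℝ) * S1.card ≤ (b + g) * (p - b + (2 * g + 1) * (b - 1)) := by
      exact_mod_cast c1
    have c2R : ((2 * b + g : ℕ) : ℝ) * S2.card ≤ (b + g) * (p - b + (2 * g + 1) * (b - 1)) := by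
      exact_mod_cast c2
    push_cast at c1R c2R
    have hlo : (s : ℝ) ≤ Real.sqrt p := Real.le_sqrt_of_sq_le (by
      rw [pow_two]; exact_mod_cast hs1)
    have hhi : Real.sqrt p ≤ s + 1 := by
      apply Real.sqrt_le_iff.mpr
      refine ⟨by positivity, ?_⟩
      rw [pow_two]; exact_mod_cast hs2.le
    have hb2R : (s : ℝ) ≤ 2 * b := by exact_mod_cast hb2
    have hb3R : (2 * b : ℝ) ≤ s + 1 := by exact_mod_cast hb3
    have hb1R : (1 : ℝ) ≤ b := by exact_mod_cast hb1
    have hg0 : (0 : ℝ) ≤ g := by positivity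
    have hnpos : (0 : ℝ) < 2 * b + g := by linarith
    set w := Real.sqrt p
    have hkey : (2 * b + g - w) ^ 2 ≤ ((g : ℝ) + 1) ^ 2 := by
      apply sq_le_sq'
      · linarith
      · linarith
    have hfin : (g : ℝ) * (p + (2 * b + g) ^ 2 - (g + 1) ^ 2) ≤ (2 * b + g) * (2 * g * w) := by
      have := mul_le_mul_of_nonneg_left hkey hg0
      have e1 : (g : ℝ) * (p + (2 * b + g) ^ 2 - (g + 1) ^ 2) - (2 * b + g) * (2 * g * w) =
          g * (2 * b + g - w) ^ 2 - g * ((g : ℝ) + 1) ^ 2 := by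
        rw [← hsq]; ring
      linarith
    rw [abs_le]
    constructor
    · rw [neg_le]
      apply le_of_mul_le_mul_left _ hnpos
      refine le_trans ?_ hfin
      have e2 : (S1.card : ℝ) = p - S2.card - (2 * g + 1) := by linarith
      rw [e2]
      linarith
    · apply le_of_mul_le_mul_left _ hnpos
      refine le_trans ?_ hfin
      have e2 : (S2.card : ℝ) = p - S1.card - (2 * g + 1) := by linarith
      rw [e2]
      linarith

lemma qc_weil (p : ℕ) [Fact p.Prime] (hodd : Odd p) (R : Finset (ZMod p)) (hne : R.Nonempty) :
    |((∑ c : ZMod p, quadraticChar (ZMod p) (∏ ρ ∈ R, (c - ρ)) : ℤ) : ℝ)| ≤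
      ((R.card : ℝ) - 1) * Real.sqrt p := by
  rcases Nat.even_or_odd R.card with hev | hod
  swap
  · obtain ⟨g, hg⟩ := hod
    have := qc_weil_odd p hodd R g hg
    have e1 : (R.card : ℝ) - 1 = 2 * g := by rw [hg]; push_cast; ring
    rwa [e1]
  obtain ⟨ρ0, hρ0⟩ := hne
  obtain ⟨g, hg⟩ : ∃ g, R.card = 2 * g + 2 := by
    obtain ⟨t, ht⟩ := hev
    have : 0 < R.card := Finset.card_pos.mpr ⟨_, hρ0⟩
    exact ⟨t - 1, by omega⟩
  have hinj : Function.Injective fun ρ : ZMod p => (ρ - ρ0)⁻¹ := by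
    intro x y hxy
    simpa using hxy
  set R' := (R.erase ρ0).image fun ρ => (ρ - ρ0)⁻¹ with hR'
  have hcard : R'.card = 2 * g + 1 := by
    rw [hR', Finset.card_image_of_injective _ hinj, Finset.card_erase_of_mem hρ0]; omega
  have hW := qc_weil_odd p hodd R' g hcard
  set χ := quadraticChar (ZMod p)
  set κ : ZMod p := ∏ ρ ∈ R.erase ρ0, (-(ρ - ρ0)) with hκ
  have hterm : ∀ u : ZMod p, u ≠ 0 → χ (∏ ρ ∈ R, (ρ0 + u⁻¹ - ρ)) =
      χ κ * χ (∏ τ ∈ R', (u - τ)) := by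
    intro u hu
    have h1 : ∏ ρ ∈ R, (ρ0 + u⁻¹ - ρ) = (u⁻¹ ^ (g + 1)) ^ 2 * (κ * ∏ τ ∈ R', (u - τ)) := by
      rw [← Finset.mul_prod_erase R _ hρ0, hR', Finset.prod_image (fun x _ y _ h => hinj h), hκ,
        ← Finset.prod_mul_distrib]
      have h2 : ∀ ρ ∈ R.erase ρ0, (ρ0 + u⁻¹ - ρ) = u⁻¹ * (-(ρ - ρ0) * (u - (ρ - ρ0)⁻¹)) := by
        intro ρ hρ
        have : ρ - ρ0 ≠ 0 := sub_ne_zero.mpr (Finset.ne_of_mem_erase hρ)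
        field_simp
        ring
      rw [Finset.prod_congr rfl h2, Finset.prod_mul_distrib, Finset.prod_const,
        Finset.card_erase_of_mem hρ0, hg]
      rw [show 2 * g + 2 - 1 = 2 * g + 1 by omega]
      ring
    rw [h1, map_mul, map_mul, quadraticChar_sq_one' (pow_ne_zero _ (inv_ne_zero hu)), one_mul]
  have hre : ∑ c : ZMod p, χ (∏ ρ ∈ R, (c - ρ)) = ∑ u : ZMod p, χ (∏ ρ ∈ R, (ρ0 + u⁻¹ - ρ)) := by
    rw [← Equiv.sum_comp ((Function.Involutive.toPerm (fun u : ZMod p => u⁻¹) inv_inv).trans (Equiv.addLeft ρ0))]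
    rfl
  have h0 : χ (∏ ρ ∈ R, (ρ0 + (0 : ZMod p)⁻¹ - ρ)) = 0 := by
    rw [Finset.prod_eq_zero hρ0 (by simp)]; simp [χ]
  have hre2 : ∑ c : ZMod p, χ (∏ ρ ∈ R, (c - ρ)) =
      χ κ * (∑ u : ZMod p, χ (∏ τ ∈ R', (u - τ)) - χ (∏ τ ∈ R', (0 - τ))) := by
    rw [hre, ← Finset.add_sum_erase _ _ (Finset.mem_univ (0 : ZMod p)), h0, zero_add,
      ← Finset.add_sum_erase _ (fun u => χ (∏ τ ∈ R', (u - τ))) (Finset.mem_univ (0 : ZMod p)),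
      add_sub_cancel_left, Finset.mul_sum]
    exact Finset.sum_congr rfl fun u hu => hterm u (Finset.ne_of_mem_erase hu)
  have habs : ∀ x : ZMod p, |((χ x : ℤ) : ℝ)| ≤ 1 := by
    intro x
    by_cases h : x = 0
    · simp [h, χ]
    · rcases quadraticChar_dichotomy h with h | h <;> simp [χ, h]
  rw [hre2, Int.cast_mul, abs_mul, Int.cast_sub, hg]
  have h3 := abs_sub ((∑ u : ZMod p, χ (∏ τ ∈ R', (u - τ)) : ℤ) : ℝ)
    ((χ (∏ τ ∈ R', (0 - τ)) : ℤ) : ℝ)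
  have h4 := habs κ
  have h5 := habs (∏ τ ∈ R', (0 - τ))
  have hp2 := (Fact.out : p.Prime).two_le
  have h6 : (1 : ℝ) ≤ Real.sqrt p := Real.one_le_sqrt.mpr (by exact_mod_cast (by omega : 1 ≤ p))
  have h7 := mul_le_mul_of_nonneg_right h4
    (abs_nonneg (((∑ u : ZMod p, χ (∏ τ ∈ R', (u - τ)) : ℤ) : ℝ) -
      ((χ (∏ τ ∈ R', (0 - τ)) : ℤ) : ℝ)))
  push_cast at *
  linarith

lemma qc_sum_card (k : ℕ) :
    2 * ∑ S : Finset (Fin k), (S.card : ℝ) = k * 2 ^ k := by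
  have h1 : ∑ S : Finset (Fin k), (S.card : ℝ) = ∑ S : Finset (Fin k), ((k : ℝ) - S.card) := by
    rw [← Equiv.sum_comp (Function.Involutive.toPerm (fun S : Finset (Fin k) => Sᶜ) compl_compl)
      (fun S : Finset (Fin k) => (S.card : ℝ))]
    refine Finset.sum_congr rfl fun S _ => ?_
    have := Finset.card_add_card_compl S
    rw [Fintype.card_fin] at this
    have h2 : (S.card : ℝ) + (Sᶜ.card : ℝ) = k := by exact_mod_cast this
    change (Sᶜ.card : ℝ) = _
    linarith
  rw [Finset.sum_sub_distrib] at h1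
  simp only [Finset.sum_const, Finset.card_univ, Fintype.card_finset, Fintype.card_fin,
    nsmul_eq_mul] at h1
  push_cast at h1
  linarith

theorem quadratic_char_pattern_count_bound (p k : ℕ) [Fact p.Prime] (hodd : Odd p)
    (a : Fin k → ZMod p) (ha : Function.Injective a)
    (ε : Fin k → ℤ) (hε : ∀ j, ε j = 1 ∨ ε j = -1) :
    |(Nat.card {c : ZMod p // ∀ j, quadraticChar (ZMod p) (c + a j) = ε j} : ℝ) -
        p / 2 ^ k| ≤
      (((k : ℝ) - 2) / 2 + 1 / 2 ^ k) * Real.sqrt p + k / 2 := by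
  classical
  set χ := quadraticChar (ZMod p) with hχ
  set N := Nat.card {c : ZMod p // ∀ j, χ (c + a j) = ε j} with hN
  have hNsum : (N : ℤ) = ∑ c : ZMod p, if (∀ j, χ (c + a j) = ε j) then (1 : ℤ) else 0 := by
    rw [Finset.sum_boole, hN, Nat.card_eq_fintype_card, Fintype.card_subtype]
  set P : ZMod p → ℤ := fun c => ∏ j, (1 + ε j * χ (c + a j)) with hP
  -- values of one factor
  have hfac : ∀ c j, (c + a j = 0 ∧ 1 + ε j * χ (c + a j) = 1) ∨
      (χ (c + a j) = ε j ∧ 1 + ε j * χ (c + a j) = 2) ∨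
      (χ (c + a j) ≠ ε j ∧ 1 + ε j * χ (c + a j) = 0) := by
    intro c j
    by_cases h : c + a j = 0
    · left; simp [h, hχ]
    · right
      rcases quadraticChar_dichotomy h with h1 | h1 <;> rcases hε j with h2 | h2 <;>
        simp [hχ, h1, h2]
  have hfac0 : ∀ c j, 0 ≤ 1 + ε j * χ (c + a j) := by
    intro c j; rcases hfac c j with h | h | h <;> rw [h.2] <;> norm_num
  have hfac2 : ∀ c j, 1 + ε j * χ (c + a j) ≤ 2 := by
    intro c j; rcases hfac c j with h | h | h <;> rw [h.2] <;> norm_num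
  have hpt : ∀ c, 0 ≤ P c - 2 ^ k * (if (∀ j, χ (c + a j) = ε j) then (1 : ℤ) else 0) ∧
      2 * (P c - 2 ^ k * (if (∀ j, χ (c + a j) = ε j) then (1 : ℤ) else 0)) ≤
        2 ^ k * ∑ j, if c + a j = 0 then (1 : ℤ) else 0 := by
    intro c
    have hr : 0 ≤ ∑ j, if c + a j = 0 then (1 : ℤ) else 0 :=
      Finset.sum_nonneg fun j _ => by split_ifs <;> norm_num
    by_cases hm : ∀ j, χ (c + a j) = ε j
    · have : P c = 2 ^ k := by
        simp only [hP]
        rw [Finset.prod_congr rfl (g := fun _ => (2 : ℤ))]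
        · simp
        · intro j _
          rw [hm j]; rcases hε j with h | h <;> rw [h] <;> norm_num
      rw [this, if_pos hm]
      constructor
      · simp
      · simp only [mul_one, sub_self, mul_zero]; positivity
    · rw [if_neg hm]
      simp only [mul_zero, sub_zero]
      refine ⟨Finset.prod_nonneg fun j _ => hfac0 c j, ?_⟩
      by_cases hz : ∃ j, c + a j = 0
      · obtain ⟨j0, hj0⟩ := hz
        have h1 : 1 ≤ ∑ j, if c + a j = 0 then (1 : ℤ) else 0 := by
          have := Finset.single_le_sum (f := fun j => if c + a j = 0 then (1 : ℤ) else 0)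
            (fun j _ => by split_ifs <;> norm_num) (Finset.mem_univ j0)
          simpa [hj0] using this
        have h2 : 2 * P c ≤ 2 ^ k := by
          simp only [hP]
          rw [← Finset.mul_prod_erase _ _ (Finset.mem_univ j0)]
          have h3 : 1 + ε j0 * χ (c + a j0) = 1 := by simp [hj0, hχ]
          rw [h3, one_mul]
          have h4 : ∏ j ∈ Finset.univ.erase j0, (1 + ε j * χ (c + a j)) ≤
              ∏ j ∈ Finset.univ.erase j0, (2 : ℤ) :=
            Finset.prod_le_prod (fun j _ => hfac0 c j) (fun j _ => hfac2 c j)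
          rw [Finset.prod_const, Finset.card_erase_of_mem (Finset.mem_univ _), Finset.card_univ,
            Fintype.card_fin] at h4
          have hk : k = (k - 1) + 1 := by have := j0.2; omega
          conv_rhs => rw [hk, pow_succ']
          linarith
        have h5 : (0 : ℤ) < 2 ^ k := by positivity
        nlinarith
      · push Not at hz hm
        obtain ⟨j, hj⟩ := hm
        have : P c = 0 := by
          apply Finset.prod_eq_zero (Finset.mem_univ j)
          rcases hfac c j with h | h | h
          · exact absurd h.1 (hz j)
          · exact absurd h.1 hj
          · exact h.2
        rw [this, mul_zero]; positivity
  set T : ℤ := ∑ c, P c with hT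
  have hzero : ∑ c : ZMod p, ∑ j, (if c + a j = 0 then (1 : ℤ) else 0) = k := by
    rw [Finset.sum_comm]
    have : ∀ j, ∑ c : ZMod p, (if c + a j = 0 then (1 : ℤ) else 0) = 1 := by
      intro j
      simp [add_eq_zero_iff_eq_neg]
    simp [this]
  have hlow : 0 ≤ T - 2 ^ k * N := by
    rw [hNsum, hT, Finset.mul_sum, ← Finset.sum_sub_distrib]
    exact Finset.sum_nonneg fun c _ => (hpt c).1
  have hupp : 2 * (T - 2 ^ k * N) ≤ 2 ^ k * k := by
    rw [← hzero, hNsum, hT, Finset.mul_sum, ← Finset.sum_sub_distrib, Finset.mul_sum,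
      Finset.mul_sum]
    exact Finset.sum_le_sum fun c _ => (hpt c).2
  -- expansion into character sums
  have hexp : T = ∑ S : Finset (Fin k), (∏ j ∈ S, ε j) * ∑ c : ZMod p, χ (∏ j ∈ S, (c + a j)) := by
    simp only [hT, hP, Finset.prod_one_add, Finset.mul_sum]
    rw [Finset.sum_comm, Finset.powerset_univ]
    refine Finset.sum_congr rfl fun S _ => Finset.sum_congr rfl fun c _ => ?_
    rw [Finset.prod_mul_distrib, map_prod]
  have hεabs : ∀ S : Finset (Fin k), |((∏ j ∈ S, ε j : ℤ) : ℝ)| = 1 := by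
    intro S
    rw [← Int.cast_abs, Finset.abs_prod, Finset.prod_eq_one]
    · simp
    · intro j _; rcases hε j with h | h <;> simp [h]
  have hbound : ∀ S ∈ Finset.univ.erase (∅ : Finset (Fin k)),
      |(((∏ j ∈ S, ε j) * ∑ c : ZMod p, χ (∏ j ∈ S, (c + a j)) : ℤ) : ℝ)| ≤
        ((S.card : ℝ) - 1) * Real.sqrt p := by
    intro S hS
    have hSne : S.Nonempty := Finset.nonempty_iff_ne_empty.mpr (Finset.ne_of_mem_erase hS)
    have hinj : Function.Injective fun j => -a j := fun x y h => ha (neg_injective h)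
    have := qc_weil p hodd (S.image fun j => -a j) (hSne.image _)
    rw [Finset.card_image_of_injective _ hinj] at this
    rw [Int.cast_mul, abs_mul, hεabs, one_mul]
    have e0 : ∀ c : ZMod p, ∏ ρ ∈ S.image (fun j => -a j), (c - ρ) = ∏ j ∈ S, (c + a j) := by
      intro c
      rw [Finset.prod_image (fun x _ y _ h => hinj h)]
      simp only [sub_neg_eq_add]
    simp only [e0] at this
    exact this
  have hTp : |(T : ℝ) - p| ≤ ((k : ℝ) * 2 ^ k / 2 - 2 ^ k + 1) * Real.sqrt p := by
    have h1 : (T : ℝ) - p = ∑ S ∈ Finset.univ.erase (∅ : Finset (Fin k)),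
        (((∏ j ∈ S, ε j) * ∑ c : ZMod p, χ (∏ j ∈ S, (c + a j)) : ℤ) : ℝ) := by
      rw [hexp, Int.cast_sum, ← Finset.add_sum_erase _ _ (Finset.mem_univ (∅ : Finset (Fin k)))]
      simp [hχ, ZMod.card]
    rw [h1]
    refine (Finset.abs_sum_le_sum_abs _ _).trans ((Finset.sum_le_sum hbound).trans ?_)
    rw [← Finset.sum_mul]
    apply le_of_eq
    congr 1
    have h2 := Finset.add_sum_erase Finset.univ (fun S : Finset (Fin k) => (S.card : ℝ) - 1)
      (Finset.mem_univ ∅)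
    have h3 := qc_sum_card k
    rw [Finset.sum_sub_distrib (s := Finset.univ)] at h2
    simp only [Finset.sum_const, Finset.card_univ, Fintype.card_finset, Fintype.card_fin,
      nsmul_eq_mul, Finset.card_empty] at h2
    push_cast at h2
    linarith
  have hlowR : (0 : ℝ) ≤ T - 2 ^ k * N := by exact_mod_cast hlow
  have huppR : 2 * ((T : ℝ) - 2 ^ k * N) ≤ 2 ^ k * k := by exact_mod_cast hupp
  have h2k : (0 : ℝ) < 2 ^ k := by positivity
  have hmain : |(2 : ℝ) ^ k * N - p| ≤
      ((k : ℝ) * 2 ^ k / 2 - 2 ^ k + 1) * Real.sqrt p + 2 ^ k * k / 2 := by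
    rw [abs_le] at hTp ⊢
    constructor <;> linarith [hTp.1, hTp.2]
  have e1 : (N : ℝ) - p / 2 ^ k = (2 ^ k * N - p) / 2 ^ k := by field_simp
  have e2 : (((k : ℝ) - 2) / 2 + 1 / 2 ^ k) * Real.sqrt p + k / 2 =
      (((k : ℝ) * 2 ^ k / 2 - 2 ^ k + 1) * Real.sqrt p + 2 ^ k * k / 2) / 2 ^ k := by
    field_simp
  rw [e1, e2, abs_div, abs_of_pos h2k]
  exact div_le_div_of_nonneg_right hmain h2k.le
end

section
/- Let m ≥ k ≥ 2 be integers and let p be a prime with p > 4^{C(m,k-1)+1}·(C(m,k-1)/2 + m + 1)², where C(m,k-1) is the binomial coefficient. Then there exists a k-Diophantine m-tuple in 𝔽_p. -/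
open Polynomial

namespace Stepanov

variable {p : ℕ} [Fact p.Prime]

/-- `E f e r = e f' r + f r'`, so that `(f^e r)' = f^(e-1) E f e r`. -/
noncomputable def E (f : (ZMod p)[X]) (e : ℕ) : (ZMod p)[X] →ₗ[ZMod p] (ZMod p)[X] :=
  LinearMap.mulLeft (ZMod p) ((e : (ZMod p)[X]) * derivative f)
    + (LinearMap.mulLeft (ZMod p) f).comp (derivative (R := ZMod p))

lemma E_apply (f : (ZMod p)[X]) (e : ℕ) (r : (ZMod p)[X]) :
    E f e r = (e : (ZMod p)[X]) * derivative f * r + f * derivative r := by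
  simp [E, mul_assoc]

noncomputable def G (f : (ZMod p)[X]) (e : ℕ) : ℕ → ((ZMod p)[X] →ₗ[ZMod p] (ZMod p)[X])
  | 0 => LinearMap.id
  | i + 1 => (E f (e - i)).comp (G f e i)

lemma iterate_der (f : (ZMod p)[X]) (e : ℕ) (r : (ZMod p)[X]) (i : ℕ) (hi : i ≤ e) :
    derivative^[i] (f ^ e * r) = f ^ (e - i) * G f e i r := by
  induction i with
  | zero => simp [G]
  | succ i ih =>
    rw [Function.iterate_succ_apply', ih (by omega)]
    obtain ⟨c, hc⟩ : ∃ c, e - i = c + 1 := ⟨e - i - 1, by omega⟩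
    have : e - (i + 1) = c := by omega
    rw [this, G, LinearMap.comp_apply, E_apply, hc, derivative_mul, derivative_pow]
    simp
    ring

lemma natDegree_E (f : (ZMod p)[X]) (e : ℕ) (r : (ZMod p)[X]) (n d : ℕ) (hd : 1 ≤ d)
    (hf : f.natDegree ≤ d) (hr : r.natDegree ≤ n) : (E f e r).natDegree ≤ n + (d - 1) := by
  rw [E_apply]
  apply natDegree_add_le_of_degree_le
  · rw [mul_assoc]
    refine (natDegree_mul_le).trans ?_
    have h1 : ((e : (ZMod p)[X])).natDegree = 0 := natDegree_natCast e
    have h2 := natDegree_derivative_le f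
    have h3 := natDegree_mul_le (p := derivative f) (q := r)
    omega
  · by_cases h0 : r.natDegree = 0
    · rw [natDegree_eq_zero] at h0
      obtain ⟨c, rfl⟩ := h0
      simp
    · have h2 := natDegree_derivative_le r
      have h3 := natDegree_mul_le (p := f) (q := derivative r)
      omega

lemma natDegree_G (f : (ZMod p)[X]) (e : ℕ) (r : (ZMod p)[X]) (n d : ℕ) (hd : 1 ≤ d)
    (hf : f.natDegree ≤ d) (hr : r.natDegree ≤ n) (i : ℕ) :
    (G f e i r).natDegree ≤ n + i * (d - 1) := by
  induction i with
  | zero => simpa [G]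
  | succ i ih =>
    rw [G, LinearMap.comp_apply]
    refine (natDegree_E f _ _ _ d hd hf ih).trans ?_
    rw [add_mul]; omega

lemma iterate_der_mul_X (q : (ZMod p)[X]) (j i : ℕ) :
    derivative^[i] (q * X ^ (p * j)) = derivative^[i] q * X ^ (p * j) := by
  induction i generalizing q with
  | zero => simp
  | succ i ih =>
    rw [Function.iterate_succ_apply, Function.iterate_succ_apply, ← ih]
    congr 1
    simp [derivative_mul, derivative_X_pow]

lemma nonvanish (f : (ZMod p)[X]) (g d : ℕ) (hg : 2 * g + 1 = p) (hf : f.natDegree ≤ d)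
    (hf0 : f.eval 0 ≠ 0) (a : ZMod p) (ha : f.rootMultiplicity a = 1) (J : ℕ) :
    ∀ (r s : ℕ → (ZMod p)[X]), (∀ j, 2 * (r j).natDegree + d < p) →
      (∀ j, 2 * (s j).natDegree + d < p) →
      ∑ j ∈ Finset.range J, (r j + s j * f ^ g) * X ^ (p * j) = 0 →
      ∀ j < J, r j = 0 ∧ s j = 0 := by
  have hfne : f ≠ 0 := by rintro rfl; simp at hf0
  induction J with
  | zero => intro r s _ _ _ j hj; omega
  | succ J ih =>
    intro r s hr hs hsum
    rw [Finset.sum_range_succ'] at hsum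
    have hfac : ∑ j ∈ Finset.range J, (r (j+1) + s (j+1) * f ^ g) * X ^ (p * (j+1))
        = X ^ p * ∑ j ∈ Finset.range J, (r (j+1) + s (j+1) * f ^ g) * X ^ (p * j) := by
      rw [Finset.mul_sum]
      refine Finset.sum_congr rfl fun j _ => ?_
      ring
    rw [hfac] at hsum
    simp only [mul_zero, pow_zero, mul_one] at hsum
    have h1 : (X : (ZMod p)[X]) ^ p ∣ r 0 + s 0 * f ^ g :=
      ⟨-∑ j ∈ Finset.range J, (r (j+1) + s (j+1) * f ^ g) * X ^ (p * j), by
        linear_combination hsum⟩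
    have h2 : (X : (ZMod p)[X]) ^ p ∣ f ^ p - C (f.eval 0) := by
      have : f ^ p - C (f.eval 0) = (f - C (f.eval 0)) ^ p := by
        rw [sub_pow_char, ← C_pow, ZMod.pow_card]
      rw [this]
      apply pow_dvd_pow_of_dvd
      rw [X_dvd_iff]
      simp [coeff_zero_eq_eval_zero]
    have h3 : (X : (ZMod p)[X]) ^ p ∣ r 0 ^ 2 * f - C (f.eval 0) * s 0 ^ 2 := by
      have : r 0 ^ 2 * f - C (f.eval 0) * s 0 ^ 2 =
          (r 0 + s 0 * f ^ g) * ((r 0 - s 0 * f ^ g) * f)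
            + (f ^ p - C (f.eval 0)) * s 0 ^ 2 := by
        have : f ^ p = f ^ g * f ^ g * f := by
          calc f ^ p = f ^ (2 * g + 1) := congrArg (f ^ ·) hg.symm
            _ = _ := by ring
        rw [this]; ring
      rw [this]
      exact dvd_add (h1.mul_right _) (h2.mul_right _)
    have h4 : r 0 ^ 2 * f - C (f.eval 0) * s 0 ^ 2 = 0 := by
      apply eq_zero_of_dvd_of_natDegree_lt h3
      rw [natDegree_X_pow]
      refine (natDegree_sub_le _ _).trans_lt (max_lt ?_ ?_)
      · have := natDegree_mul_le (p := r 0 ^ 2) (q := f)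
        have := natDegree_pow_le (p := r 0) (n := 2)
        have := hr 0
        omega
      · have := natDegree_C_mul_le (f.eval 0) (s 0 ^ 2)
        have := natDegree_pow_le (p := s 0) (n := 2)
        have := hs 0
        omega
    have h5 : r 0 = 0 := by
      by_contra hr0
      have hs0 : s 0 ≠ 0 := by
        intro h
        rw [h] at h4
        simp [hr0, hfne] at h4
      have h6 := congrArg (rootMultiplicity a) (sub_eq_zero.mp h4)
      have hC : C (f.eval 0) ≠ (0 : (ZMod p)[X]) := C_ne_zero.mpr hf0
      rw [rootMultiplicity_mul (mul_ne_zero (pow_ne_zero _ hr0) hfne),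
        rootMultiplicity_mul (mul_ne_zero hC (pow_ne_zero _ hs0)), ha,
        rootMultiplicity_C, pow_two, pow_two, rootMultiplicity_mul (mul_ne_zero hr0 hr0),
        rootMultiplicity_mul (mul_ne_zero hs0 hs0)] at h6
      omega
    have h6 : s 0 = 0 := by
      rw [h5] at h4
      simpa [hf0] using h4
    rw [h5, h6] at hsum
    have hX : (X : (ZMod p)[X]) ^ p ≠ 0 := pow_ne_zero _ X_ne_zero
    have h7 := ih (fun j => r (j+1)) (fun j => s (j+1)) (fun j => hr _) (fun j => hs _)
      (by simpa [hX] using hsum)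
    intro j hj
    rcases j with _ | j
    · exact ⟨h5, h6⟩
    · exact h7 j (by omega)

lemma count_roots (R : (ZMod p)[X]) (hR : R ≠ 0) (S : Finset (ZMod p)) (l : ℕ)
    (h : ∀ a ∈ S, l ≤ R.rootMultiplicity a) : l * S.card ≤ R.natDegree := by
  have h1 : ∏ a ∈ S, (X - C a) ^ l ∣ R := by
    apply Finset.prod_dvd_of_coprime
    · intro a _ b _ hab
      exact ((pairwise_coprime_X_sub_C Function.injective_id) hab).pow
    · intro a ha
      exact (pow_dvd_pow _ (h a ha)).trans (pow_rootMultiplicity_dvd R a)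
  have h2 := natDegree_le_of_dvd h1 hR
  rw [natDegree_prod _ _ (fun a _ => pow_ne_zero _ (X_sub_C_ne_zero a))] at h2
  simpa [mul_comm] using h2


lemma exists_aux (f : (ZMod p)[X]) (g d : ℕ) (hd : 1 ≤ d) (hf : f.natDegree ≤ d) (ε : ZMod p)
    (l M J W : ℕ) (hM : 1 ≤ M) (hW : M + J + l * (d - 1) ≤ W) (hlt : l * W < 2 * (J * M)) :
    ∃ r s : ℕ → (ZMod p)[X], (∀ j, (r j).natDegree ≤ M - 1) ∧ (∀ j, (s j).natDegree ≤ M - 1) ∧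
      (∃ j < J, ¬ (r j = 0 ∧ s j = 0)) ∧
      ∀ i < l, ∑ j ∈ Finset.range J,
        (G f l i (r j) + C ε * G f (l + g) i (s j)) * X ^ j = 0 := by
  let V := (Fin J → degreeLT (ZMod p) M) × (Fin J → degreeLT (ZMod p) M)
  let Q : ℕ → V →ₗ[ZMod p] (ZMod p)[X] := fun i =>
    ∑ j : Fin J, (LinearMap.mulRight (ZMod p) ((X : (ZMod p)[X]) ^ (j : ℕ))).comp
      (((G f l i).comp ((degreeLT (ZMod p) M).subtype.comp
          ((LinearMap.proj j).comp (LinearMap.fst _ _ _))))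
        + ε • ((G f (l + g) i).comp ((degreeLT (ZMod p) M).subtype.comp
          ((LinearMap.proj j).comp (LinearMap.snd _ _ _)))))
  have hQ : ∀ i (v : V), Q i v = ∑ j : Fin J,
      (G f l i (v.1 j : (ZMod p)[X]) + C ε * G f (l + g) i (v.2 j : (ZMod p)[X])) * X ^ (j : ℕ) := by
    intro i v
    simp [Q, smul_eq_C_mul]
    rfl
  let Φ : V →ₗ[ZMod p] (Fin l → Fin W → ZMod p) :=
    LinearMap.pi fun i => LinearMap.pi fun w => (lcoeff (ZMod p) (w : ℕ)).comp (Q i)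
  have hfd : Module.finrank (ZMod p) (degreeLT (ZMod p) M) = M := by
    rw [(degreeLTEquiv (ZMod p) M).finrank_eq]; simp
  have : FiniteDimensional (ZMod p) (degreeLT (ZMod p) M) :=
    Module.Finite.equiv (degreeLTEquiv (ZMod p) M).symm
  have hker : LinearMap.ker Φ ≠ ⊥ := by
    apply LinearMap.ker_ne_bot_of_finrank_lt
    have hpi : Module.finrank (ZMod p) (Fin J → degreeLT (ZMod p) M) = J * M := by
      rw [Module.finrank_pi_fintype]; simp [hfd]
    rw [Module.finrank_prod, hpi, Module.finrank_pi_fintype]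
    simp
    linarith
  obtain ⟨v, hv, hv0⟩ := (Submodule.ne_bot_iff _).mp hker
  have hdeg : ∀ q : degreeLT (ZMod p) M, (q : (ZMod p)[X]).natDegree ≤ M - 1 := by
    intro q
    have := mem_degreeLT.mp q.2
    by_cases hq : (q : (ZMod p)[X]) = 0
    · simp [hq]
    · have := (natDegree_lt_iff_degree_lt hq).mpr this
      omega
  refine ⟨fun j => if h : j < J then v.1 ⟨j, h⟩ else 0,
    fun j => if h : j < J then v.2 ⟨j, h⟩ else 0, ?_, ?_, ?_, ?_⟩
  · intro j
    dsimp only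
    split_ifs
    · exact hdeg _
    · simp
  · intro j
    dsimp only
    split_ifs
    · exact hdeg _
    · simp
  · by_contra! hcon
    apply hv0
    ext j : 3
    · have := (hcon j j.2).1
      simpa using this
    · have := (hcon j j.2).2
      simpa using this
  · intro i hi
    have h1 : Q i v = 0 := by
      ext w
      by_cases hw : w < W
      · have := congrFun (congrFun (LinearMap.mem_ker.mp hv) ⟨i, hi⟩) ⟨w, hw⟩
        simpa [Φ] using this
      · rw [coeff_zero]
        apply coeff_eq_zero_of_natDegree_lt
        have hle : (Q i v).natDegree ≤ (M - 1) + i * (d - 1) + (J - 1) := by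
          rw [hQ]
          apply natDegree_sum_le_of_forall_le
          intro j _
          refine natDegree_mul_le.trans ?_
          rw [natDegree_X_pow]
          have hj := j.2
          have : (G f l i (v.1 j : (ZMod p)[X])
              + C ε * G f (l + g) i (v.2 j : (ZMod p)[X])).natDegree ≤ (M - 1) + i * (d - 1) := by
            apply natDegree_add_le_of_degree_le
            · exact natDegree_G f _ _ _ d hd hf (hdeg _) i
            · exact (natDegree_C_mul_le _ _).trans (natDegree_G f _ _ _ d hd hf (hdeg _) i)
          omega
        have : i * (d - 1) ≤ l * (d - 1) := Nat.mul_le_mul_right _ hi.le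
        omega
    rw [← h1, hQ, Finset.sum_range]
    refine Finset.sum_congr rfl fun j _ => ?_
    simp

lemma card_bound (f : (ZMod p)[X]) (g d : ℕ) (hg : 2 * g + 1 = p) (hd : 1 ≤ d)
    (hf : f.natDegree ≤ d) (hf0 : f.eval 0 ≠ 0) (a : ZMod p) (ha : f.rootMultiplicity a = 1)
    (ε : ZMod p) (l M J : ℕ) (hM : 1 ≤ M) (hMp : 2 * (M - 1) + d < p) (hlp : l ≤ p)
    (hlt : l * (M + J + l * (d - 1)) < 2 * (J * M))
    (S : Finset (ZMod p)) (hS : ∀ x ∈ S, f.eval x ^ g = ε) :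
    l * S.card ≤ d * l + (M - 1) + d * g + p * (J - 1) := by
  obtain ⟨r, s, hr, hs, ⟨j0, hj0, hne⟩, hQ⟩ :=
    exists_aux f g d hd hf ε l M J _ hM le_rfl hlt
  set R0 : (ZMod p)[X] := ∑ j ∈ Finset.range J, (r j + s j * f ^ g) * X ^ (p * j) with hR0
  have hfne : f ≠ 0 := by rintro rfl; simp at hf0
  have hR0ne : R0 ≠ 0 := by
    intro h
    refine hne (nonvanish f g d hg hf hf0 a ha J r s ?_ ?_ h j0 hj0)
    · intro j; have := hr j; omega
    · intro j; have := hs j; omega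
  have hRne : f ^ l * R0 ≠ 0 := mul_ne_zero (pow_ne_zero _ hfne) hR0ne
  have hRform : f ^ l * R0 = ∑ j ∈ Finset.range J,
      ((f ^ l * r j) * X ^ (p * j) + (f ^ (l + g) * s j) * X ^ (p * j)) := by
    rw [hR0, Finset.mul_sum]
    refine Finset.sum_congr rfl fun j _ => ?_
    ring
  have hder : ∀ i < l, ∀ x ∈ S, (derivative^[i] (f ^ l * R0)).eval x = 0 := by
    intro i hi x hx
    have h1 : derivative^[i] (f ^ l * R0) = ∑ j ∈ Finset.range J,
      ((f ^ (l - i) * G f l i (r j)) * X ^ (p * j)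
        + (f ^ (l + g - i) * G f (l + g) i (s j)) * X ^ (p * j)) := by
      rw [hRform, iterate_derivative_sum]
      refine Finset.sum_congr rfl fun j _ => ?_
      rw [iterate_map_add, iterate_der_mul_X, iterate_der_mul_X, iterate_der _ _ _ _ hi.le,
        iterate_der _ _ _ _ (by omega)]
    have h2 := congrArg (eval x) (hQ i hi)
    have h3 : (derivative^[i] (f ^ l * R0)).eval x = f.eval x ^ (l - i) *
        eval x (∑ j ∈ Finset.range J,
        (G f l i (r j) + C ε * G f (l + g) i (s j)) * X ^ j) := by
      rw [h1, eval_finsetSum, eval_finsetSum, Finset.mul_sum]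
      refine Finset.sum_congr rfl fun j _ => ?_
      have h4 : x ^ (p * j) = x ^ j := by rw [pow_mul, ZMod.pow_card]
      have h5 : l + g - i = (l - i) + g := by omega
      simp only [eval_add, eval_mul, eval_pow, eval_X, eval_C, h4, h5, pow_add, hS x hx]
      ring
    rw [h3, h2]; simp
  have hmult : ∀ x ∈ S, l ≤ (f ^ l * R0).rootMultiplicity x := by
    intro x hx
    rcases l with _ | l
    · simp
    · apply lt_rootMultiplicity_of_isRoot_iterate_derivative_of_mem_nonZeroDivisors hRne
      · intro i hi
        exact hder i (by omega) x hx
      · rw [mem_nonZeroDivisors_iff_ne_zero, Ne, CharP.cast_eq_zero_iff (ZMod p) p,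
          (Fact.out : p.Prime).dvd_factorial]
        omega
  refine (count_roots _ hRne S l hmult).trans ?_
  have hJ : 1 ≤ J := by omega
  have h1 : R0.natDegree ≤ (M - 1) + d * g + p * (J - 1) := by
    apply natDegree_sum_le_of_forall_le
    intro j hj
    rw [Finset.mem_range] at hj
    refine natDegree_mul_le.trans ?_
    rw [natDegree_X_pow]
    have h2 : p * j ≤ p * (J - 1) := Nat.mul_le_mul_left _ (by omega)
    have h3 : (r j + s j * f ^ g).natDegree ≤ (M - 1) + d * g := by
      apply natDegree_add_le_of_degree_le
      · have := hr j; omega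
      · refine natDegree_mul_le.trans ?_
        have h4 := natDegree_pow_le (p := f) (n := g)
        have h5 : g * f.natDegree ≤ d * g := by rw [mul_comm]; exact Nat.mul_le_mul_right _ hf
        have := hs j
        omega
    omega
  have h2 := natDegree_mul_le (p := f ^ l) (q := R0)
  have h3 := natDegree_pow_le (p := f) (n := l)
  have h4 : l * f.natDegree ≤ d * l := by rw [mul_comm]; exact Nat.mul_le_mul_right _ hf
  omega

/-- Numerical form: `4t² ≤ p`, `t ≥ 2d`, `l = 2t`. -/
lemma card_bound' (f : (ZMod p)[X]) (g d t : ℕ) (hg : 2 * g + 1 = p) (hd : 1 ≤ d)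
    (hf : f.natDegree ≤ d) (hf0 : f.eval 0 ≠ 0) (a : ZMod p) (ha : f.rootMultiplicity a = 1)
    (ε : ZMod p) (ht : 4 * t ^ 2 ≤ p) (htd : 2 * d ≤ t)
    (S : Finset (ZMod p)) (hS : ∀ x ∈ S, f.eval x ^ g = ε) :
    2 * t * (2 * S.card) ≤ 4 * d * t + 3 * d * p + 2 * t * p := by
  have hdp : 2 * d ≤ p := by nlinarith
  obtain ⟨M, hM1, hM2⟩ : ∃ M, 2 * M + d ≤ p + 1 ∧ p ≤ 2 * M + d := ⟨(p + 1 - d) / 2, by omega, by omega⟩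
  have h := card_bound f g d hg hd hf hf0 a ha ε (2 * t) M (t + d) (by omega) (by omega)
    (by nlinarith) (by
      obtain ⟨e, rfl⟩ : ∃ e, d = e + 1 := ⟨d - 1, by omega⟩
      simp only [Nat.add_sub_cancel]
      zify at *
      nlinarith) S hS
  obtain ⟨e, he⟩ : ∃ e, t + d - 1 = e ∧ t + d = e + 1 := ⟨t + d - 1, by omega⟩
  rw [he.1] at h
  have h2 : 2 * (M - 1) + d + 1 ≤ p ∨ M = 0 := by omega
  have h3 : 2 * (M - 1) ≤ p := by omega
  have h4 : d * (2 * g) ≤ d * p := Nat.mul_le_mul_left _ (by omega)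
  have h5 : p * e + p = p * t + p * d := by rw [← mul_add, he.2]; ring
  nlinarith

noncomputable def F (T : Finset (ZMod p)) : (ZMod p)[X] := ∏ c ∈ T, (C c * X + 1)

lemma F_eval (T : Finset (ZMod p)) (x : ZMod p) : (F T).eval x = ∏ c ∈ T, (c * x + 1) := by
  simp [F, eval_prod]

lemma F_natDegree (T : Finset (ZMod p)) : (F T).natDegree ≤ T.card := by
  refine (natDegree_prod_le _ _).trans ?_
  refine (Finset.sum_le_card_nsmul _ _ 1 ?_).trans (by simp)
  intro c _
  simpa using natDegree_linear_le (a := c) (b := 1)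

lemma F_ne_zero (T : Finset (ZMod p)) : F T ≠ 0 := by
  intro h
  have := F_eval T 0
  rw [h] at this
  simp at this

lemma F_mult (T : Finset (ZMod p)) (h0 : 0 ∉ T) (c : ZMod p) (hc : c ∈ T) :
    (F T).rootMultiplicity (-c⁻¹) = 1 := by
  have hc0 : c ≠ 0 := fun h => h0 (h ▸ hc)
  have h1 : F T = C c * (X - C (-c⁻¹)) * F (T.erase c) := by
    rw [F, ← Finset.mul_prod_erase T _ hc, F]
    congr 1
    rw [mul_sub, ← C_mul]
    simp [hc0]
  have hne := F_ne_zero T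
  rw [h1] at hne ⊢
  rw [rootMultiplicity_mul hne, rootMultiplicity_mul (left_ne_zero_of_mul hne), rootMultiplicity_C,
    rootMultiplicity_X_sub_C_self, rootMultiplicity_eq_zero]
  rw [IsRoot, F_eval, Finset.prod_eq_zero_iff]
  rintro ⟨b, hb, hb0⟩
  apply Finset.ne_of_mem_erase hb
  field_simp at hb0
  linear_combination -hb0

lemma charsum (T : Finset (ZMod p)) (h0 : 0 ∉ T) (hT : T.Nonempty) (t : ℕ) (hp2 : p ≠ 2)
    (ht : 4 * t ^ 2 ≤ p) (htd : 2 * T.card ≤ t) :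
    -((T.card : ℤ) * (6 * t + 3 * p)) ≤
      2 * t * ∑ x : ZMod p, ∏ c ∈ T, quadraticChar (ZMod p) (c * x + 1) := by
  obtain ⟨c0, hc0⟩ := hT
  have hodd : p % 2 = 1 := (Fact.out : p.Prime).eq_two_or_odd.resolve_left hp2
  obtain ⟨g, hg⟩ : ∃ g, 2 * g + 1 = p := ⟨p / 2, by omega⟩
  have hchar : ringChar (ZMod p) ≠ 2 := by rwa [ZMod.ringChar_zmod_n]
  classical
  set S := Finset.univ.filter (fun x : ZMod p => (F T).eval x ^ g = -1) with hS
  set Z := Finset.univ.filter (fun x : ZMod p => (F T).eval x = 0) with hZ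
  have hb := card_bound' (F T) g T.card t hg (Finset.card_pos.mpr ⟨c0, hc0⟩) (F_natDegree T)
    (by rw [F_eval]; simp) _ (F_mult T h0 c0 hc0) (-1) ht htd S (by simp [hS])
  have hz : Z.card ≤ T.card := by
    have h := card_le_degree_of_subset_roots (p := F T) (Z := Z) (by
      intro x hx
      have hx' : x ∈ Z := hx
      rw [mem_roots (F_ne_zero T)]
      simpa [hZ] using hx')
    exact h.trans (F_natDegree T)
  have hpt : ∀ x : ZMod p, (1 : ℤ) - 2 * (if (F T).eval x ^ g = -1 then 1 else 0)
      - (if (F T).eval x = 0 then 1 else 0) ≤ ∏ c ∈ T, quadraticChar (ZMod p) (c * x + 1) := by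
    intro x
    rw [← map_prod, ← F_eval]
    set y := (F T).eval x
    by_cases hy : y = 0
    · have : (0 : ZMod p) ^ g ≠ -1 := by
        have : g ≠ 0 := by
          rintro rfl
          exact (Fact.out : p.Prime).one_lt.ne' hg.symm
        simp [this]
      simp [hy, this]
    · have hg' : Fintype.card (ZMod p) / 2 = g := by rw [ZMod.card]; omega
      rcases quadraticChar_dichotomy hy with h | h
      · rw [h]
        split_ifs <;> norm_num
      · have h2 := quadraticChar_eq_pow_of_char_ne_two' hchar y
        rw [h, hg'] at h2
        push_cast at h2
        simp [← h2, h, hy]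
  have hsum := Finset.sum_le_sum (fun x (_ : x ∈ Finset.univ) => hpt x)
  rw [Finset.sum_sub_distrib, Finset.sum_sub_distrib, ← Finset.mul_sum, Finset.sum_boole,
    Finset.sum_boole, ← hS, ← hZ] at hsum
  simp only [Finset.sum_const, Finset.card_univ, ZMod.card, nsmul_eq_mul, mul_one] at hsum
  have h2 := mul_le_mul_of_nonneg_left hsum (by positivity : (0 : ℤ) ≤ 2 * t)
  refine le_trans ?_ h2
  zify at hb hz
  have h3 : (t : ℤ) * Z.card ≤ t * T.card := mul_le_mul_of_nonneg_left hz (by positivity)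
  linarith

lemma sum_card_pow {α : Type*} [DecidableEq α] (D : Finset α) :
    2 * ∑ T ∈ D.powerset, (T.card : ℤ) = D.card * 2 ^ D.card := by
  induction D using Finset.induction_on with
  | empty => simp
  | insert a D ha ih =>
    rw [Finset.sum_powerset_insert ha, Finset.card_insert_of_notMem ha]
    have : ∑ T ∈ D.powerset, ((insert a T).card : ℤ) = ∑ T ∈ D.powerset, ((T.card : ℤ) + 1) := by
      refine Finset.sum_congr rfl fun T hT => ?_
      rw [Finset.card_insert_of_notMem (fun h => ha (Finset.mem_powerset.mp hT h))]
      push_cast; rfl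
    rw [this, Finset.sum_add_distrib]
    simp only [Finset.sum_const, Finset.card_powerset, nsmul_eq_mul]
    push_cast
    rw [pow_succ]
    linarith

lemma extend (D B : Finset (ZMod p)) (h0 : 0 ∉ D) (m t : ℕ) (hB : B.card ≤ m)
    (ht : 4 * t ^ 2 < p) (hDt : 2 ^ D.card * (D.card + 2 * m + 3) ≤ t) :
    ∃ x, x ∉ B ∧ ∀ c ∈ D, IsSquare (c * x + 1) := by
  classical
  by_contra! hcon
  have h2n : 1 ≤ 2 ^ D.card := Nat.one_le_two_pow
  have ht3 : 3 ≤ t := by nlinarith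
  have hp2 : p ≠ 2 := by rintro h; nlinarith
  set n := D.card with hn
  have hpt : ∀ x : ZMod p, ∏ c ∈ D, (1 + quadraticChar (ZMod p) (c * x + 1)) ≤
      2 ^ n * (if x ∈ B then 1 else 0) := by
    intro x
    have hle : ∀ y : ZMod p, 0 ≤ 1 + quadraticChar (ZMod p) y ∧
        1 + quadraticChar (ZMod p) y ≤ 2 := by
      intro y
      by_cases hy : y = 0
      · simp [hy]
      · rcases quadraticChar_dichotomy hy with h | h <;> simp [h]
    split_ifs with hx
    · rw [mul_one]
      exact (Finset.prod_le_prod (fun c _ => (hle _).1) (fun c _ => (hle _).2)).trans (by simp [hn])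
    · obtain ⟨c, hc, hsq⟩ := hcon x hx
      rw [Finset.prod_eq_zero hc, mul_zero]
      rw [quadraticChar_neg_one_iff_not_isSquare.mpr hsq]
      norm_num
  have hsum := Finset.sum_le_sum (fun x (_ : x ∈ Finset.univ) => hpt x)
  rw [← Finset.mul_sum, Finset.sum_boole] at hsum
  simp only [Finset.filter_mem_eq_inter, Finset.univ_inter] at hsum
  have hexp : ∑ x : ZMod p, ∏ c ∈ D, (1 + quadraticChar (ZMod p) (c * x + 1)) =
      ∑ T ∈ D.powerset, ∑ x : ZMod p, ∏ c ∈ T, quadraticChar (ZMod p) (c * x + 1) := by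
    rw [Finset.sum_comm]
    refine Finset.sum_congr rfl fun x _ => ?_
    rw [Finset.prod_one_add]
  have hT : ∀ T ∈ D.powerset, (if T = ∅ then 2 * (t : ℤ) * p else 0)
      - ((T.card : ℤ) * (6 * t + 3 * p)) ≤
      2 * t * ∑ x : ZMod p, ∏ c ∈ T, quadraticChar (ZMod p) (c * x + 1) := by
    intro T hTD
    rw [Finset.mem_powerset] at hTD
    split_ifs with hE
    · subst hE
      simp
    · have hc : T.card ≤ n := Finset.card_le_card hTD
      have := charsum T (fun h => h0 (hTD h)) (Finset.nonempty_iff_ne_empty.mpr hE) t hp2 ht.le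
        (by
          rcases Nat.eq_zero_or_pos n with h | h
          · omega
          · have : 2 ^ 1 ≤ 2 ^ n := Nat.pow_le_pow_right (by norm_num) h
            nlinarith)
      linarith
  have hS := Finset.sum_le_sum hT
  rw [← Finset.mul_sum, ← hexp, Finset.sum_sub_distrib, ← Finset.sum_mul,
    Finset.sum_ite_eq' ] at hS
  simp only [Finset.empty_mem_powerset, if_true] at hS
  have hcp := sum_card_pow D
  rw [← hn] at hcp
  have hA : (2 : ℤ) * t * ∑ x : ZMod p, ∏ c ∈ D, (1 + quadraticChar (ZMod p) (c * x + 1))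
      ≤ 2 * t * (2 ^ n * m) := by
    apply mul_le_mul_of_nonneg_left _ (by positivity)
    refine hsum.trans ?_
    apply mul_le_mul_of_nonneg_left _ (by positivity)
    exact_mod_cast hB
  have h1 : 4 * (t : ℤ) * p ≤ 2 ^ n * (4 * t * m + 6 * t * n + 3 * p * n) := by
    have : 2 * ((∑ T ∈ D.powerset, (T.card : ℤ)) * (6 * t + 3 * p))
      = n * 2 ^ n * (6 * t + 3 * p) := by rw [← hcp]; ring
    linarith
  have h2 : (2 : ℤ) ^ n * (n + 2 * m + 3) ≤ t := by exact_mod_cast hDt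
  have h3 : 4 * (t : ℤ) ^ 2 < p := by exact_mod_cast ht
  have h4 : 4 * ((2 : ℤ) ^ n * (n + 2 * m + 3)) * p ≤ 4 * t * p := by
    apply mul_le_mul_of_nonneg_right _ (by positivity); linarith
  have h5 : (4 * ((n : ℤ) + 2 * m + 3)) * p ≤ 4 * t * m + 6 * t * n + 3 * p * n := by
    have hpos : (0 : ℤ) < 2 ^ n := by positivity
    refine le_of_mul_le_mul_left ?_ hpos
    linarith
  have ht3' : (3 : ℤ) ≤ t := by exact_mod_cast ht3
  have h6 : 12 * (t : ℤ) ≤ p := by nlinarith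
  have h7 : 12 * (t : ℤ) * n ≤ p * n := mul_le_mul_of_nonneg_right h6 (by positivity)
  have h8 : 12 * (t : ℤ) * m ≤ p * m := mul_le_mul_of_nonneg_right h6 (by positivity)
  have h9 : 0 ≤ (t : ℤ) * n := by positivity
  have h10 : 0 ≤ (t : ℤ) * m := by positivity
  linarith

end Stepanov

theorem exists_k_diophantine_m_tuple (k m p : ℕ) (hk : 2 ≤ k) (hm : k ≤ m)
    (hp : p.Prime)
    (hbig : 4 ^ (m.choose (k - 1) + 1) *
        ((m.choose (k - 1) : ℚ) / 2 + m + 1) ^ 2 < p) :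
    ∃ S : Finset (ZMod p), S.card = m ∧ (0 : ZMod p) ∉ S ∧
      ∀ T ⊆ S, T.card = k → IsSquare (T.prod id + 1) := by
  haveI : Fact p.Prime := ⟨hp⟩
  set N := m.choose (k - 1) with hN
  set n := (m - 1).choose (k - 1) with hn
  set t := 2 ^ n * (n + 2 * m + 3) with ht
  have hnN : n + 1 ≤ N := by
    obtain ⟨m', rfl⟩ : ∃ m', m = m' + 1 := ⟨m - 1, by omega⟩
    obtain ⟨k', rfl⟩ : ∃ k', k = k' + 2 := ⟨k - 2, by omega⟩
    have h1 : k' + 2 - 1 = k' + 1 := by omega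
    rw [hN, hn, h1, Nat.choose_succ_succ', Nat.add_sub_cancel]
    have : 0 < m'.choose k' := Nat.choose_pos (by omega)
    omega
  have htp : 4 * t ^ 2 < p := by
    have h1 : ((4 * t ^ 2 : ℕ) : ℚ) < p := by
      refine lt_of_le_of_lt ?_ hbig
      have h2 : (4 : ℚ) ^ (N + 1) * ((N : ℚ) / 2 + m + 1) ^ 2 = 4 ^ N * (N + 2 * m + 2) ^ 2 := by
        rw [pow_succ]; ring
      have h3 : ((4 * t ^ 2 : ℕ) : ℚ) = 4 ^ (n + 1) * (((n + 1 : ℕ) : ℚ) + 2 * m + 2) ^ 2 := by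
        have h4 : (4 : ℚ) ^ (n + 1) = 4 * (2 ^ n) ^ 2 := by
          rw [pow_succ, ← pow_mul, mul_comm n 2, pow_mul]; norm_num; ring
        rw [ht, h4]
        push_cast
        ring
      rw [h2, h3]
      have h5 : ((n + 1 : ℕ) : ℚ) ≤ N := by exact_mod_cast hnN
      gcongr
      norm_num
    exact_mod_cast h1
  have key : ∀ j ≤ m, ∃ S : Finset (ZMod p), S.card = j ∧ (0 : ZMod p) ∉ S ∧
      ∀ T ⊆ S, T.card = k → IsSquare (T.prod id + 1) := by
    intro j
    induction j with
    | zero =>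
      intro _
      refine ⟨∅, by simp, by simp, ?_⟩
      intro T hT hc
      rw [Finset.subset_empty.mp hT] at hc
      simp at hc
      omega
    | succ j ih =>
      intro hj
      obtain ⟨S, hS, hS0, hSq⟩ := ih (by omega)
      set D := (S.powersetCard (k - 1)).image (fun T => T.prod id) with hD
      have hDn : D.card ≤ n := by
        refine Finset.card_image_le.trans ?_
        rw [Finset.card_powersetCard, hS]
        exact Nat.choose_le_choose _ (by omega)
      obtain ⟨x, hxB, hx⟩ := Stepanov.extend D (insert 0 S) (by
          rw [hD, Finset.mem_image]
          rintro ⟨T, hT, hT0⟩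
          rw [Finset.prod_eq_zero_iff] at hT0
          obtain ⟨a, ha, ha0⟩ := hT0
          exact hS0 (ha0 ▸ (Finset.mem_powersetCard.mp hT).1 ha)) m t
        ((Finset.card_insert_le _ _).trans (by omega)) htp (by
          rw [ht]
          gcongr
          norm_num)
      rw [Finset.mem_insert, not_or] at hxB
      refine ⟨insert x S, by rw [Finset.card_insert_of_notMem hxB.2, hS], ?_, ?_⟩
      · rw [Finset.mem_insert, not_or]
        exact ⟨fun h => hxB.1 h.symm, hS0⟩
      · intro T hT hc
        by_cases hxT : x ∈ T
        · rw [← Finset.prod_erase_mul T id hxT]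
          apply hx
          rw [hD, Finset.mem_image]
          refine ⟨T.erase x, ?_, rfl⟩
          rw [Finset.mem_powersetCard]
          exact ⟨Finset.subset_insert_iff.mp hT, by rw [Finset.card_erase_of_mem hxT, hc]⟩
        · exact hSq T ((Finset.subset_insert_iff_of_notMem hxT).mp hT) hc
  exact key m le_rfl
end

section
/- Let m ≥ 3 be an integer and p a prime with p > 2^{m²−m−2}·(m²+3m+4)². Then there exists a 3-Diophantine m-tuple in 𝔽_p. -/
open Polynomial

noncomputable def stepOp {K : Type*} [Field K] (f : K[X]) (n : ℕ) : ℕ → (K[X] →ₗ[K] K[X])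
  | 0 => LinearMap.id
  | k + 1 => LinearMap.mulLeft K f ∘ₗ derivative ∘ₗ stepOp f n k +
      LinearMap.mulLeft K (((n - k : ℕ) : K[X]) * derivative f) ∘ₗ stepOp f n k

theorem stepOp_spec {K : Type*} [Field K] (f : K[X]) (n : ℕ) (s u : K[X])
    (hu : derivative u = 0) (k : ℕ) (hk : k ≤ n) :
    derivative^[k] (f ^ n * s * u) = f ^ (n - k) * stepOp f n k s * u := by
  induction k with
  | zero => simp [stepOp]
  | succ k ih =>
    rw [Function.iterate_succ_apply', ih (by omega)]
    obtain ⟨c, hc⟩ : ∃ c, n - k = c + 1 := ⟨n - k - 1, by omega⟩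
    have hc' : n - (k + 1) = c := by omega
    simp only [stepOp, hc, hc', derivative_mul, hu, derivative_pow, LinearMap.add_apply,
      LinearMap.comp_apply, LinearMap.mulLeft_apply, Nat.add_sub_cancel, mul_zero, add_zero]
    simp only [map_natCast]
    ring

theorem stepOp_natDegree {K : Type*} [Field K] (f : K[X]) (n : ℕ) (s : K[X]) (k : ℕ) :
    (stepOp f n k s).natDegree ≤ s.natDegree + k * f.natDegree := by
  induction k with
  | zero => simp [stepOp]
  | succ k ih =>
    simp only [stepOp, LinearMap.add_apply,
      LinearMap.comp_apply, LinearMap.mulLeft_apply]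
    have h1 := natDegree_derivative_le (stepOp f n k s)
    have h2 := natDegree_derivative_le f
    refine natDegree_add_le_of_degree_le ?_ ?_
    · refine natDegree_mul_le.trans ?_
      rw [add_mul]; omega
    · refine natDegree_mul_le.trans ?_
      have h3 := natDegree_mul_le (p := ((n - k : ℕ) : K[X])) (q := derivative f)
      rw [natDegree_natCast] at h3
      rw [add_mul]; omega

theorem nat_of_mem {K : Type*} [Field K] {A : ℕ} (hA : 0 < A) {s : K[X]}
    (hs : s ∈ degreeLT K A) : s.natDegree < A := by
  rw [mem_degreeLT] at hs
  by_cases h : s = 0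
  · simpa [h]
  · exact (natDegree_lt_iff_degree_lt h).2 hs

theorem exists_coeffs {K : Type*} [Field K] (f : K[X]) (a : K) (l n A J : ℕ) (hA : 0 < A)
    (h : l * (A + l * f.natDegree + J) < 2 * J * A) :
    ∃ r s : ℕ → K[X], (∀ j, (r j).natDegree < A) ∧ (∀ j, (s j).natDegree < A) ∧
      (∃ j < J, r j ≠ 0 ∨ s j ≠ 0) ∧
      ∀ k < l, ∑ j ∈ Finset.range J,
        (stepOp f l k (r j) + C a * stepOp f n k (s j)) * X ^ j = 0 := by
  classical
  set B := A + l * f.natDegree + J with hB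
  let V := Fin J → degreeLT K A
  let Φ : ℕ → (V × V →ₗ[K] K[X]) := fun k => ∑ j : Fin J,
    LinearMap.mulRight K (X ^ (j : ℕ)) ∘ₗ
      (stepOp f l k ∘ₗ (degreeLT K A).subtype ∘ₗ LinearMap.proj j ∘ₗ LinearMap.fst K V V +
       LinearMap.mulLeft K (C a) ∘ₗ
        stepOp f n k ∘ₗ (degreeLT K A).subtype ∘ₗ LinearMap.proj j ∘ₗ LinearMap.snd K V V)
  have hΦ : ∀ k v, Φ k v = ∑ j : Fin J,
      (stepOp f l k (v.1 j : K[X]) + C a * stepOp f n k (v.2 j : K[X])) * X ^ (j : ℕ) := by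
    intro k v
    simp [Φ, LinearMap.sum_apply]
    rfl
  let L : V × V →ₗ[K] (Fin l → Fin B → K) :=
    LinearMap.pi fun k => LinearMap.pi fun i => lcoeff K (i : ℕ) ∘ₗ Φ k
  have hfin : Module.finrank K (degreeLT K A) = A := by
    rw [(degreeLTEquiv K A).finrank_eq]; simp
  have : Module.Finite K (degreeLT K A) := Module.Finite.equiv (degreeLTEquiv K A).symm
  have hker : LinearMap.ker L ≠ ⊥ := by
    apply LinearMap.ker_ne_bot_of_finrank_lt
    have hV : Module.finrank K V = J * A := by
      change Module.finrank K (Fin J → degreeLT K A) = J * A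
      rw [Module.finrank_pi_fintype]
      simp [hfin]
    rw [Module.finrank_prod, hV, Module.finrank_pi_fintype]
    simp only [Module.finrank_fintype_fun_eq_card, Fintype.card_fin, Finset.sum_const,
      Finset.card_univ, smul_eq_mul]
    linarith
  obtain ⟨v, hv, hv0⟩ := (Submodule.ne_bot_iff _).1 hker
  refine ⟨fun j => if hj : j < J then (v.1 ⟨j, hj⟩ : K[X]) else 0,
    fun j => if hj : j < J then (v.2 ⟨j, hj⟩ : K[X]) else 0, ?_, ?_, ?_, ?_⟩
  · intro j
    dsimp only
    split_ifs
    · exact nat_of_mem hA (v.1 _).2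
    · simpa
  · intro j
    dsimp only
    split_ifs
    · exact nat_of_mem hA (v.2 _).2
    · simpa
  · by_contra hcon
    push Not at hcon
    apply hv0
    ext j : 2
    · have := (hcon j j.2).1
      simp only [Fin.is_lt, dif_pos, Fin.eta] at this
      exact Subtype.ext this
    · have := (hcon j j.2).2
      simp only [Fin.is_lt, dif_pos, Fin.eta] at this
      exact Subtype.ext this
  · intro k hk
    rw [Finset.sum_range]
    simp only [Fin.is_lt, dif_pos, Fin.eta]
    rw [← hΦ]
    have hdeg : (Φ k v).natDegree < B := by
      rw [hΦ]
      have : 0 < B := by omega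
      refine (natDegree_sum_le_of_forall_le (n := B - 1) _ _ ?_).trans_lt (by omega)
      intro j _
      have h1 := stepOp_natDegree f l (v.1 j : K[X]) k
      have h2 := stepOp_natDegree f n (v.2 j : K[X]) k
      have h3 := nat_of_mem hA (v.1 j).2
      have h4 := nat_of_mem hA (v.2 j).2
      have h5 : k * f.natDegree ≤ l * f.natDegree := Nat.mul_le_mul_right _ hk.le
      have h6 := j.2
      have h7 : (stepOp f l k (v.1 j : K[X]) + C a * stepOp f n k (v.2 j : K[X])).natDegree
          ≤ A - 1 + l * f.natDegree := by
        refine natDegree_add_le_of_degree_le (by omega) ?_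
        refine (natDegree_C_mul_le _ _).trans (by omega)
      refine natDegree_mul_le.trans ?_
      rw [natDegree_X_pow]
      omega
    ext i
    rw [coeff_zero]
    by_cases hi : i < B
    · have := congrFun (congrFun (LinearMap.mem_ker.1 hv) ⟨k, hk⟩) ⟨i, hi⟩
      simpa [L] using this
    · exact coeff_eq_zero_of_natDegree_lt (by omega)

theorem nonvanish {p : ℕ} [Fact p.Prime] (f : (ZMod p)[X]) (e A : ℕ) (he : p = 2 * e + 1)
    (hA : 2 * (A - 1) + f.natDegree < p) (hf0 : f.coeff 0 ≠ 0) (α : ZMod p)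
    (hα : f.rootMultiplicity α = 1) (J : ℕ) :
    ∀ r s : ℕ → (ZMod p)[X], (∀ j, (r j).natDegree < A) → (∀ j, (s j).natDegree < A) →
      ∑ j ∈ Finset.range J, (r j + f ^ e * s j) * (X ^ j) ^ p = 0 →
      ∀ j < J, r j = 0 ∧ s j = 0 := by
  have hf : f ≠ 0 := by rintro rfl; simp at hf0
  induction J with
  | zero => intro r s _ _ _ j hj; omega
  | succ J ih =>
    intro r s hr hs h
    rw [Finset.sum_range_succ'] at h
    have key : ∀ a b : (ZMod p)[X], a.natDegree < A → b.natDegree < A → ∀ q0 q1 : (ZMod p)[X],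
        (a + X ^ p * q0) + f ^ e * (b + X ^ p * q1) = 0 → a = 0 ∧ b = 0 := by
      intro a b ha hb q0 q1 hab
      have h1 : f * (a + X ^ p * q0) ^ 2 = f ^ p * (b + X ^ p * q1) ^ 2 := by
        have : a + X ^ p * q0 = - (f ^ e * (b + X ^ p * q1)) := by
          linear_combination hab
        rw [this]
        have hpe : f ^ p = f ^ (2 * e + 1) := congrArg _ he
        rw [hpe]
        ring
      obtain ⟨q, hq⟩ : ∃ q, f ^ p = C (f.coeff 0) + X ^ p * q := by
        rw [← ZMod.expand_card]
        obtain ⟨q, hq⟩ := X_dvd_sub_C (p := f)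
        refine ⟨expand (ZMod p) p q, ?_⟩
        have : f = C (f.coeff 0) + X * q := by linear_combination hq
        conv_lhs => rw [this]
        simp
      have h2 : X ^ p ∣ f * a ^ 2 - C (f.coeff 0) * b ^ 2 := by
        rw [hq] at h1
        refine ⟨q * (b + X ^ p * q1) ^ 2 + C (f.coeff 0) * (2 * b * q1 + X ^ p * q1 ^ 2)
          - f * (2 * a * q0 + X ^ p * q0 ^ 2), ?_⟩
        linear_combination h1
      have h3 : f * a ^ 2 - C (f.coeff 0) * b ^ 2 = 0 := by
        apply eq_zero_of_dvd_of_natDegree_lt h2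
        rw [natDegree_X_pow]
        refine lt_of_le_of_lt (natDegree_sub_le_of_le (m := 2 * (A - 1) + f.natDegree)
          (n := 2 * (A - 1) + f.natDegree) ?_ ?_) (by simpa using hA)
        · refine natDegree_mul_le.trans ?_
          have := natDegree_pow_le (p := a) (n := 2)
          omega
        · refine (natDegree_C_mul_le _ _).trans ?_
          have := natDegree_pow_le (p := b) (n := 2)
          omega
      have h4 : f * a ^ 2 = C (f.coeff 0) * b ^ 2 := sub_eq_zero.1 h3
      have hC : C (f.coeff 0) ≠ 0 := by simpa using hf0
      by_cases ha0 : a = 0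
      · refine ⟨ha0, ?_⟩
        rw [ha0] at h4
        have : C (f.coeff 0) * b ^ 2 = 0 := by rw [← h4]; simp
        simpa [hf0] using this
      · exfalso
        have hb0 : b ≠ 0 := by
          rintro rfl
          have : f * a ^ 2 = 0 := by rw [h4]; simp
          simp [hf, ha0] at this
        have h5 := congrArg (rootMultiplicity α) h4
        rw [rootMultiplicity_mul (mul_ne_zero hf (pow_ne_zero _ ha0)),
          rootMultiplicity_mul (mul_ne_zero hC (pow_ne_zero _ hb0)), hα, rootMultiplicity_C,
          pow_two, pow_two, rootMultiplicity_mul (mul_ne_zero ha0 ha0),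
          rootMultiplicity_mul (mul_ne_zero hb0 hb0)] at h5
        omega
    have h0 : r 0 = 0 ∧ s 0 = 0 := by
      refine key (r 0) (s 0) (hr 0) (hs 0)
        (∑ j ∈ Finset.range J, r (j + 1) * (X ^ j) ^ p)
        (∑ j ∈ Finset.range J, s (j + 1) * (X ^ j) ^ p) ?_
      rw [← h]
      simp only [mul_add, Finset.mul_sum, add_mul, Finset.sum_add_distrib]
      simp only [pow_zero, one_pow, mul_one]
      have e1 : ∀ j, r (j+1) * (X ^ (j + 1)) ^ p = X ^ p * (r (j + 1) * (X ^ j) ^ p) := by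
        intro j; ring
      have e2 : ∀ j, f ^ e * s (j+1) * (X ^ (j + 1)) ^ p
          = f ^ e * (X ^ p * (s (j + 1) * (X ^ j) ^ p)) := by
        intro j; ring
      simp only [e1, e2]
      ring
    have h1 : ∑ j ∈ Finset.range J, (r (j + 1) + f ^ e * s (j + 1)) * (X ^ j) ^ p = 0 := by
      rw [h0.1, h0.2] at h
      have : X ^ p * ∑ j ∈ Finset.range J, (r (j + 1) + f ^ e * s (j + 1)) * (X ^ j) ^ p
          = (0 : (ZMod p)[X]) := by
        rw [Finset.mul_sum, ← h]
        simp only [mul_zero, add_zero, zero_mul]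
        refine Finset.sum_congr rfl fun j _ => ?_
        ring
      exact (mul_eq_zero.1 this).resolve_left (pow_ne_zero _ X_ne_zero)
    have h2 := ih (fun j => r (j + 1)) (fun j => s (j + 1)) (fun j => hr _) (fun j => hs _) h1
    intro j hj
    rcases j with _ | j
    · exact h0
    · exact h2 j (by omega)

theorem stepanov {p : ℕ} [Fact p.Prime] (f : (ZMod p)[X]) (a : ZMod p) (e A l J d : ℕ)
    (he : p = 2 * e + 1) (hd : f.natDegree = d) (hA0 : 0 < A)
    (hA : 2 * (A - 1) + d < p) (hf0 : f.coeff 0 ≠ 0) (α : ZMod p)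
    (hα : f.rootMultiplicity α = 1) (hl0 : 0 < l) (hl : l ≤ p)
    (h : l * (A + l * d + J) < 2 * J * A) :
    l * (Finset.univ.filter (fun x : ZMod p => (f.eval x) ^ e = a)).card
      ≤ d * (l + e) + (A - 1) + (J - 1) * p := by
  classical
  subst hd
  have hf : f ≠ 0 := by rintro rfl; simp at hf0
  obtain ⟨r, s, hr, hs, ⟨j0, hj0, hne⟩, hz⟩ := exists_coeffs f a l (l + e) A J hA0 h
  set F : (ZMod p)[X] := ∑ j ∈ Finset.range J,
    (f ^ l * r j * (X ^ j) ^ p + f ^ (l + e) * s j * (X ^ j) ^ p) with hF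
  have hF0 : F ≠ 0 := by
    intro h0
    have h1 : f ^ l * ∑ j ∈ Finset.range J, (r j + f ^ e * s j) * (X ^ j) ^ p = 0 := by
      rw [← h0, hF, Finset.mul_sum]
      refine Finset.sum_congr rfl fun j _ => ?_
      ring
    have h2 := (mul_eq_zero.1 h1).resolve_left (pow_ne_zero _ hf)
    have h3 := nonvanish f e A he hA hf0 α hα J r s hr hs h2 j0 hj0
    rcases hne with h4 | h4
    · exact h4 h3.1
    · exact h4 h3.2
  have hdeg : F.natDegree ≤ f.natDegree * (l + e) + (A - 1) + (J - 1) * p := by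
    refine natDegree_sum_le_of_forall_le _ _ ?_
    intro j hj
    have hj' := Finset.mem_range.1 hj
    have hx : (((X : (ZMod p)[X]) ^ j) ^ p).natDegree ≤ (J - 1) * p := by
      rw [← pow_mul, natDegree_X_pow]
      exact Nat.mul_le_mul_right _ (by omega)
    have hr' := hr j
    have hs' := hs j
    refine natDegree_add_le_of_degree_le ?_ ?_
    · refine natDegree_mul_le.trans (add_le_add (natDegree_mul_le.trans
        (add_le_add (natDegree_pow_le.trans ?_) (by omega))) hx)
      rw [mul_comm]
      exact Nat.mul_le_mul_left _ (by omega)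
    · refine natDegree_mul_le.trans (add_le_add (natDegree_mul_le.trans
        (add_le_add (natDegree_pow_le.trans ?_) (by omega))) hx)
      rw [mul_comm]
  have hroot : ∀ x ∈ Finset.univ.filter (fun x : ZMod p => (f.eval x) ^ e = a),
      l ≤ F.roots.count x := by
    intro x hx
    have hx' := (Finset.mem_filter.1 hx).2
    rw [count_roots]
    have : l - 1 < F.rootMultiplicity x := by
      apply lt_rootMultiplicity_of_isRoot_iterate_derivative_of_mem_nonZeroDivisors hF0
      · intro k hk
        have hkl : k < l := by omega
        have hder : ∀ j : ℕ, derivative (((X : (ZMod p)[X]) ^ j) ^ p) = 0 := by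
          intro j
          rw [derivative_pow]
          simp
        have hDF : derivative^[k] F = ∑ j ∈ Finset.range J,
            (f ^ (l - k) * stepOp f l k (r j) * (X ^ j) ^ p
              + f ^ (l + e - k) * stepOp f (l + e) k (s j) * (X ^ j) ^ p) := by
          rw [hF, iterate_derivative_sum]
          refine Finset.sum_congr rfl fun j _ => ?_
          rw [iterate_map_add, stepOp_spec _ _ _ _ (hder j) _ hkl.le,
            stepOp_spec _ _ _ _ (hder j) _ (by omega)]
        rw [hDF, IsRoot.def, eval_finsetSum]
        have hzz := congrArg (eval x) (hz k hkl)
        rw [eval_finsetSum, eval_zero] at hzz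
        have : f.eval x ^ (l - k) * ∑ j ∈ Finset.range J,
          eval x ((stepOp f l k (r j) + C a * stepOp f (l + e) k (s j)) * X ^ j) = 0 := by
          rw [hzz, mul_zero]
        rw [← this, Finset.mul_sum]
        refine Finset.sum_congr rfl fun j _ => ?_
        have hle : l + e - k = (l - k) + e := by omega
        simp only [eval_add, eval_mul, eval_pow, eval_X, eval_C, hle, ZMod.pow_card, pow_add, hx']
        ring
      · apply mem_nonZeroDivisors_of_ne_zero
        rw [Ne, ZMod.natCast_eq_zero_iff, (Fact.out : p.Prime).dvd_factorial]
        omega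
    omega
  calc l * (Finset.univ.filter (fun x : ZMod p => (f.eval x) ^ e = a)).card
      = ∑ x ∈ Finset.univ.filter (fun x : ZMod p => (f.eval x) ^ e = a), l := by
        rw [Finset.sum_const, smul_eq_mul, mul_comm]
    _ ≤ ∑ x ∈ Finset.univ.filter (fun x : ZMod p => (f.eval x) ^ e = a), F.roots.count x :=
        Finset.sum_le_sum hroot
    _ ≤ ∑ x : ZMod p, F.roots.count x :=
        Finset.sum_le_sum_of_subset (Finset.subset_univ _)
    _ = Multiset.card F.roots := by
        exact Multiset.sum_count_eq_card (fun x _ => Finset.mem_univ x)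
    _ ≤ F.natDegree := card_roots' F
    _ ≤ _ := hdeg

theorem stepanov_clean {p : ℕ} [Fact p.Prime] (f : (ZMod p)[X]) (a : ZMod p) (e t d : ℕ)
    (he : p = 2 * e + 1) (hd : f.natDegree = d) (hd1 : 1 ≤ d) (hf0 : f.coeff 0 ≠ 0) (α : ZMod p)
    (hα : f.rootMultiplicity α = 1) (ht : 9 ≤ t) (htd : 4 * d ≤ t) (h1 : 4 * t ^ 2 ≤ p)
    (h2 : p ≤ 5 * t ^ 2) :
    2 * (Finset.univ.filter (fun x : ZMod p => (f.eval x) ^ e = a)).card ≤ p + 12 * d * t := by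
  have hdp : d + 10 ≤ p := by nlinarith
  obtain ⟨A, hA⟩ : ∃ A, A = (p + 1 - d) / 2 := ⟨_, rfl⟩
  have hA1 : 2 * A + d ≤ p + 1 := by omega
  have hA2 : p ≤ 2 * A + d := by omega
  have key := stepanov f a e A (2 * t) (t + d + 1) d he hd (by omega) (by omega) hf0 α hα
    (by omega) (by nlinarith) (by
      have : t * (2 * t * d + t + d + 1) < (d + 1) * A := by nlinarith
      nlinarith)
  set M := (Finset.univ.filter (fun x : ZMod p => (f.eval x) ^ e = a)).card
  have e1 : t + d + 1 - 1 = t + d := by omega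
  rw [e1] at key
  have h3 : 4 * t * M ≤ 2 * t * p + (3 * d + 1) * p + 4 * d * t := by
    have : 2 * (A - 1) ≤ p := by omega
    have : 2 * e ≤ p := by omega
    nlinarith
  have h4 : (2 * t) * (2 * M) ≤ (2 * t) * (p + 12 * d * t) := by
    have : (3 * d + 1) * p ≤ 4 * d * (5 * t ^ 2) := Nat.mul_le_mul (by omega) h2
    have : d * t ≤ d * t * t := Nat.le_mul_of_pos_right _ (by omega)
    nlinarith
  exact Nat.le_of_mul_le_mul_left h4 (by omega)

theorem linProd_natDegree {K : Type*} [Field K] (I : Finset K) (h0 : (0 : K) ∉ I) :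
    (∏ w ∈ I, (C w * X + C 1 : K[X])).natDegree = I.card := by
  have hw : ∀ w ∈ I, (C w * X + C 1 : K[X]).natDegree = 1 := fun w hw =>
    natDegree_linear (fun h => h0 (h ▸ hw))
  rw [natDegree_prod _ _ (fun w hwI h => by have := hw w hwI; rw [h] at this; simp at this),
    Finset.sum_congr rfl hw]
  simp

theorem linProd_rootMultiplicity {K : Type*} [Field K] [DecidableEq K] (I : Finset K)
    (h0 : (0 : K) ∉ I) (w : K) (hw : w ∈ I) :
    (∏ w ∈ I, (C w * X + C 1 : K[X])).rootMultiplicity (-w⁻¹) = 1 := by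
  have hw0 : w ≠ 0 := fun h => h0 (h ▸ hw)
  rw [← Finset.mul_prod_erase _ _ hw]
  have e1 : (C w * X + C 1 : K[X]) = C w * (X - C (-w⁻¹)) := by
    rw [mul_sub, ← C_mul]
    simp [hw0]
  have e2 : eval (-w⁻¹) (∏ w ∈ I.erase w, (C w * X + C 1 : K[X])) ≠ 0 := by
    rw [eval_prod, Finset.prod_ne_zero_iff]
    intro v hv h
    simp only [eval_add, eval_mul, eval_C, eval_X] at h
    apply Finset.ne_of_mem_erase hv
    field_simp at h
    linear_combination -h
  have e3 : (∏ w ∈ I.erase w, (C w * X + C 1 : K[X])) ≠ 0 := by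
    intro h; rw [h] at e2; simp at e2
  have e4 : (C w * (X - C (-w⁻¹)) : K[X]) ≠ 0 :=
    mul_ne_zero (by simpa using hw0) (X_sub_C_ne_zero _)
  rw [e1, rootMultiplicity_mul (mul_ne_zero e4 e3), rootMultiplicity_mul e4,
    rootMultiplicity_C, rootMultiplicity_X_sub_C_self, rootMultiplicity_eq_zero e2]

theorem char_sum_bound {p : ℕ} [Fact p.Prime] (t : ℕ) (I : Finset (ZMod p))
    (h0 : (0 : ZMod p) ∉ I) (hI : I.Nonempty)
    (ht : 9 ≤ t) (htd : 4 * I.card ≤ t) (h1 : 4 * t ^ 2 ≤ p) (h2 : p ≤ 5 * t ^ 2) :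
    -(13 * I.card * t : ℤ) ≤
      ∑ x : ZMod p, ∏ w ∈ I, quadraticChar (ZMod p) (w * x + 1) := by
  classical
  have hp2 : p ≠ 2 := by intro h; nlinarith
  have hodd : p % 2 = 1 := (Fact.out : p.Prime).eq_two_or_odd.resolve_left hp2
  obtain ⟨e, he⟩ : ∃ e, p = 2 * e + 1 := ⟨p / 2, by omega⟩
  obtain ⟨w, hw⟩ := hI
  set f : (ZMod p)[X] := ∏ w ∈ I, (C w * X + C 1) with hf
  have hdeg : f.natDegree = I.card := linProd_natDegree I h0
  have hcard : 1 ≤ I.card := Finset.card_pos.2 ⟨w, hw⟩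
  have hf0 : f.coeff 0 ≠ 0 := by
    rw [coeff_zero_eq_eval_zero, hf, eval_prod]
    simp
  have hM := stepanov_clean f (-1) e t I.card he hdeg hcard hf0 (-w⁻¹)
    (linProd_rootMultiplicity I h0 w hw) ht htd h1 h2
  have hfne : f ≠ 0 := by intro h; rw [h] at hf0; simp at hf0
  have hev : ∀ x, ∏ w ∈ I, quadraticChar (ZMod p) (w * x + 1)
      = quadraticChar (ZMod p) (f.eval x) := by
    intro x
    rw [hf, eval_prod, map_prod]
    simp
  simp only [hev]
  have hpt : ∀ y : ZMod p, (1 : ℤ) - (if y = 0 then 1 else 0) - 2 * (if y ^ e = -1 then 1 else 0)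
      ≤ quadraticChar (ZMod p) y := by
    intro y
    by_cases hy : y = 0
    · have : (0 : ℤ) ≤ (if y ^ e = -1 then 1 else 0) := by split_ifs <;> simp
      rw [if_pos hy, hy, quadraticChar_zero]
      rw [hy] at this
      linarith
    · rw [if_neg hy]
      rcases quadraticChar_dichotomy hy with h | h
      · rw [h]
        split_ifs <;> simp
      · have h3 := quadraticChar_eq_pow_of_char_ne_two' (F := ZMod p)
          (by rwa [ZMod.ringChar_zmod_n]) y
        rw [h, ZMod.card, show p / 2 = e by omega] at h3
        rw [if_pos (by rw [← h3]; simp), h]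
        norm_num
  have hsum := Finset.sum_le_sum (fun x (_ : x ∈ (Finset.univ : Finset (ZMod p))) =>
    hpt (f.eval x))
  refine le_trans ?_ hsum
  rw [Finset.sum_sub_distrib, Finset.sum_sub_distrib, ← Finset.mul_sum, Finset.sum_boole,
    Finset.sum_boole]
  have hz : (Finset.univ.filter (fun x : ZMod p => f.eval x = 0)).card ≤ I.card := by
    rw [← hdeg]
    refine le_trans (Finset.card_le_card (t := f.roots.toFinset) ?_)
      ((Multiset.toFinset_card_le _).trans (card_roots' f))
    intro x hx
    simpa [hfne] using hx
  have hpc : ∑ x : ZMod p, (1 : ℤ) = p := by simp [ZMod.card]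
  rw [hpc]
  zify at hM hz ht
  have : (I.card : ℤ) ≤ I.card * t := by nlinarith
  linarith

theorem good_count {p : ℕ} [Fact p.Prime] (t k : ℕ) (W : Finset (ZMod p))
    (h0 : (0 : ZMod p) ∉ W) (hk : W.card ≤ k)
    (ht : 9 ≤ t) (htd : 4 * k ≤ t) (h1 : 4 * t ^ 2 ≤ p) (h2 : p ≤ 5 * t ^ 2) :
    p ≤ 2 ^ k * (13 * k * t +
      (Finset.univ.filter (fun x : ZMod p => ∀ w ∈ W, IsSquare (w * x + 1))).card) := by
  classical
  set G := Finset.univ.filter (fun x : ZMod p => ∀ w ∈ W, IsSquare (w * x + 1)) with hG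
  have hp2 : p ≠ 2 := by intro h; nlinarith
  have hlow : (p : ℤ) - 2 ^ k * (13 * k * t) ≤
      ∑ x : ZMod p, ∏ w ∈ W, (1 + quadraticChar (ZMod p) (w * x + 1)) := by
    simp only [Finset.prod_one_add]
    rw [Finset.sum_comm, ← Finset.sum_erase_add _ _ (Finset.empty_mem_powerset W)]
    have hpc : ∑ x : ZMod p, (1 : ℤ) = p := by simp [ZMod.card]
    simp only [Finset.prod_empty, hpc]
    have : ∑ I ∈ W.powerset.erase ∅, (-(13 * k * t : ℤ)) ≤ ∑ I ∈ W.powerset.erase ∅,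
        ∑ x : ZMod p, ∏ w ∈ I, quadraticChar (ZMod p) (w * x + 1) := by
      refine Finset.sum_le_sum fun I hI => ?_
      have hIW := Finset.mem_powerset.1 (Finset.mem_of_mem_erase hI)
      have hIk : I.card ≤ k := (Finset.card_le_card hIW).trans hk
      refine le_trans ?_ (char_sum_bound t I (fun h => h0 (hIW h))
        (Finset.nonempty_iff_ne_empty.2 (Finset.ne_of_mem_erase hI)) ht (by omega) h1 h2)
      have : 13 * I.card * t ≤ 13 * k * t := by gcongr
      zify at this
      linarith
    rw [Finset.sum_const, nsmul_eq_mul] at this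
    have hc : (W.powerset.erase ∅).card ≤ 2 ^ k :=
      (Finset.card_le_card (Finset.erase_subset _ _)).trans (by
        rw [Finset.card_powerset]; exact Nat.pow_le_pow_right (by norm_num) hk)
    have hc' : (W.powerset.erase ∅).card * (13 * k * t) ≤ 2 ^ k * (13 * k * t) :=
      Nat.mul_le_mul_right _ hc
    zify at hc'
    linarith
  have hup : ∑ x : ZMod p, ∏ w ∈ W, (1 + quadraticChar (ZMod p) (w * x + 1)) ≤ 2 ^ k * G.card := by
    have : ∀ x : ZMod p, ∏ w ∈ W, (1 + quadraticChar (ZMod p) (w * x + 1)) ≤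
        2 ^ k * (if x ∈ G then 1 else 0 : ℤ) := by
      intro x
      have hb : ∀ y : ZMod p, 0 ≤ 1 + quadraticChar (ZMod p) y ∧
          1 + quadraticChar (ZMod p) y ≤ 2 := by
        intro y
        by_cases hy : y = 0
        · rw [hy, quadraticChar_zero]; norm_num
        · rcases quadraticChar_dichotomy hy with h | h <;> rw [h] <;> norm_num
      by_cases hx : x ∈ G
      · rw [if_pos hx, mul_one]
        calc ∏ w ∈ W, (1 + quadraticChar (ZMod p) (w * x + 1)) ≤ ∏ w ∈ W, (2 : ℤ) :=
              Finset.prod_le_prod (fun w _ => (hb _).1) (fun w _ => (hb _).2)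
          _ = 2 ^ W.card := by simp
          _ ≤ 2 ^ k := pow_le_pow_right₀ (by norm_num) hk
      · rw [if_neg hx, mul_zero]
        apply le_of_eq
        simp only [hG, Finset.mem_filter, Finset.mem_univ, true_and, not_forall] at hx
        obtain ⟨w, hw, hns⟩ := hx
        refine Finset.prod_eq_zero hw ?_
        rw [quadraticChar_neg_one_iff_not_isSquare.2 hns]
        norm_num
    refine (Finset.sum_le_sum fun x _ => this x).trans ?_
    rw [← Finset.mul_sum, Finset.sum_boole]
    simp
  zify
  linarith

theorem final_bound (B k n Q t p : ℕ) (hB : 2 ≤ B) (hn : 2 ≤ n) (hk : 2 * k ≤ n * n)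
    (hQ : Q = 2 * k + 6 * n + 8) (hlow : B * (n * Q) ≤ 2 * t + 1) (ht : 1 ≤ t)
    (h1 : 4 * t ^ 2 ≤ p) : B * (13 * k * t + (n + 1)) < p := by
  have h5 : 13 * k + 2 * n + 2 ≤ 2 * (n * Q) := by
    have e : n * Q = 2 * (n * k) + 6 * (n * n) + 8 * n := by rw [hQ]; ring
    omega
  have h6 : B * (13 * k + 2 * n + 2) ≤ B * (2 * (n * Q)) := Nat.mul_le_mul_left _ h5
  have h7 : B * (13 * k + n + 1) < 4 * t := by
    have h9 : 2 * 3 ≤ B * (n + 1) := Nat.mul_le_mul hB (by omega)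
    have e1 : B * (13 * k + 2 * n + 2) = B * (13 * k + n + 1) + B * (n + 1) := by ring
    have e2 : B * (2 * (n * Q)) = 2 * (B * (n * Q)) := by ring
    omega
  have h8 : B * (13 * k * t + (n + 1)) ≤ B * (13 * k + n + 1) * t := by
    rw [mul_assoc B]
    refine Nat.mul_le_mul_left _ ?_
    have h9 : n + 1 ≤ (n + 1) * t := Nat.le_mul_of_pos_right _ ht
    have e1 : (13 * k + n + 1) * t = 13 * k * t + (n + 1) * t := by ring
    omega
  have h9 : B * (13 * k + n + 1) * t < 4 * t * t := Nat.mul_lt_mul_of_pos_right h7 ht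
  have e : 4 * t * t = 4 * t ^ 2 := by ring
  omega

theorem exists_3_diophantine_m_tuple (m p : ℕ) (hm : 3 ≤ m) (hp : p.Prime)
    (hbig : 2 ^ (m ^ 2 - m - 2) * (m ^ 2 + 3 * m + 4) ^ 2 < p) :
    ∃ S : Finset (ZMod p), S.card = m ∧ (0 : ZMod p) ∉ S ∧
      ∀ T ⊆ S, T.card = 3 → IsSquare (T.prod id + 1) := by
  classical
  have : Fact p.Prime := ⟨hp⟩
  obtain ⟨n, rfl⟩ : ∃ n, m = n + 1 := ⟨m - 1, by omega⟩
  obtain ⟨k, hk⟩ : ∃ k, k = n.choose 2 := ⟨_, rfl⟩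
  have hk2 : 2 * k = n * (n - 1) := by
    rw [hk, Nat.choose_two_right, Nat.mul_div_cancel']
    exact (Nat.even_mul_pred_self n).two_dvd
  obtain ⟨n', hn'⟩ : ∃ n', n = n' + 1 := ⟨n - 1, by omega⟩
  have hk3 : 2 * k = (n' + 1) * n' := by rw [hk2, hn']; simp
  have hexp : (n + 1) ^ 2 - (n + 1) - 2 = 2 * (k + n - 1) := by
    have e1 : (n + 1) ^ 2 = 2 * k + 2 * n + n + 1 := by rw [hn']; nlinarith
    omega
  obtain ⟨Q, hQ⟩ : ∃ Q, Q = (n + 1) ^ 2 + 3 * (n + 1) + 4 := ⟨_, rfl⟩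
  have hQ2 : Q = 2 * k + 6 * n + 8 := by rw [hQ, hn']; nlinarith
  obtain ⟨t, ht⟩ : ∃ t, t = Nat.sqrt (p / 4) := ⟨_, rfl⟩
  have ht1 : 4 * t ^ 2 ≤ p := by
    have := Nat.sqrt_le' (p / 4)
    rw [← ht] at this
    omega
  have ht2 : p < 4 * (t + 1) ^ 2 := by
    have := Nat.lt_succ_sqrt' (p / 4)
    rw [← ht, Nat.succ_eq_add_one] at this
    omega
  have hpow : 2 ^ (k + n - 1) = 2 ^ k * 2 ^ (n - 1) := by
    rw [← pow_add]; congr 1; omega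
  have hlt : 2 ^ (k + n - 1) * Q < 2 * (t + 1) := by
    rw [hexp, ← hQ, mul_comm 2, pow_mul, ← mul_pow] at hbig
    have h3 : (2 ^ (k + n - 1) * Q) ^ 2 < (2 * (t + 1)) ^ 2 := by
      rw [mul_pow 2]; omega
    exact lt_of_pow_lt_pow_left₀ 2 (by omega) h3
  have hnpow : n ≤ 2 ^ (n - 1) := by
    have := Nat.lt_two_pow_self (n := n - 1)
    omega
  have hB : 1 ≤ 2 ^ k := Nat.one_le_two_pow
  have hlow : 2 ^ k * (n * Q) ≤ 2 * t + 1 := by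
    have : 2 ^ k * (n * Q) ≤ 2 ^ (k + n - 1) * Q := by
      rw [hpow, ← mul_assoc]; gcongr
    omega
  have hk1 : 1 ≤ k := by nlinarith
  have hn2 : 2 ≤ n := by omega
  -- crude consequences
  have hB2 : 2 ≤ 2 ^ k := by
    calc 2 = 2 ^ 1 := by norm_num
      _ ≤ 2 ^ k := Nat.pow_le_pow_right (by norm_num) hk1
  have hnQ : 2 * Q ≤ n * Q := Nat.mul_le_mul_right _ hn2
  have hBnQ : 2 * (2 * Q) ≤ 2 ^ k * (n * Q) := Nat.mul_le_mul hB2 hnQ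
  have ht9 : 9 ≤ t := by omega
  have ht4 : 4 * k ≤ t := by omega
  have ht5 : p ≤ 5 * t ^ 2 := by
    have : 9 * t ≤ t * t := Nat.mul_le_mul_right _ ht9
    have e1 : 4 * (t + 1) ^ 2 = 4 * (t * t) + 8 * t + 4 := by ring
    have e2 : 5 * t ^ 2 = 5 * (t * t) := by ring
    omega
  have hfinal : 2 ^ k * (13 * k * t + (n + 1)) < p :=
    final_bound (2 ^ k) k n Q t p hB2 hn2 (by rw [hk2]; exact Nat.mul_le_mul_left _ (by omega))
      hQ2 hlow (by omega) ht1
  have main : ∀ r ≤ n + 1, ∃ S : Finset (ZMod p), S.card = r ∧ (0 : ZMod p) ∉ S ∧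
      ∀ T ⊆ S, T.card = 3 → IsSquare (T.prod id + 1) := by
    intro r
    induction r with
    | zero =>
      intro _
      refine ⟨∅, by simp, by simp, ?_⟩
      intro T hT hc
      rw [Finset.subset_empty.1 hT] at hc
      simp at hc
    | succ r ih =>
      intro hr
      obtain ⟨S, hS, hS0, hST⟩ := ih (by omega)
      set W := (S.powersetCard 2).image (fun U => U.prod id) with hW
      have hW0 : (0 : ZMod p) ∉ W := by
        intro h
        obtain ⟨U, hU, hU0⟩ := Finset.mem_image.1 h
        obtain ⟨y, hy, hy0⟩ := Finset.prod_eq_zero_iff.1 hU0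
        have := (Finset.mem_powersetCard.1 hU).1 hy
        simp only [id] at hy0
        exact hS0 (hy0 ▸ this)
      have hWk : W.card ≤ k := by
        refine Finset.card_image_le.trans ?_
        rw [Finset.card_powersetCard, hS, hk]
        exact Nat.choose_le_choose 2 (by omega)
      have hcount := good_count t k W hW0 hWk ht9 ht4 ht1 ht5
      set G := Finset.univ.filter (fun x : ZMod p => ∀ w ∈ W, IsSquare (w * x + 1)) with hG
      have hGc : n + 1 < G.card := by
        by_contra hcon
        have : 2 ^ k * (13 * k * t + G.card) ≤ 2 ^ k * (13 * k * t + (n + 1)) :=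
          Nat.mul_le_mul_left _ (by omega)
        omega
      have hins : (insert 0 S).card < G.card :=
        lt_of_le_of_lt (Finset.card_insert_le _ _) (by omega)
      obtain ⟨x, hxG, hxS⟩ := Finset.exists_mem_notMem_of_card_lt_card hins
      rw [Finset.mem_insert, not_or] at hxS
      refine ⟨insert x S, by rw [Finset.card_insert_of_notMem hxS.2, hS], ?_, ?_⟩
      · rw [Finset.mem_insert, not_or]
        exact ⟨fun h => hxS.1 h.symm, hS0⟩
      · intro T hT hT3
        by_cases hxT : x ∈ T
        · have h1 : T.erase x ∈ S.powersetCard 2 := by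
            rw [Finset.mem_powersetCard]
            refine ⟨?_, by rw [Finset.card_erase_of_mem hxT, hT3]⟩
            intro y hy
            exact (Finset.mem_insert.1 (hT (Finset.mem_of_mem_erase hy))).resolve_left
              (Finset.ne_of_mem_erase hy)
          have h2 := (Finset.mem_filter.1 hxG).2 _ (Finset.mem_image_of_mem _ h1)
          rw [← Finset.prod_erase_mul _ _ hxT]
          exact h2
        · refine hST T ?_ hT3
          intro y hy
          exact (Finset.mem_insert.1 (hT hy)).resolve_left (fun h => hxT (h ▸ hy))
  exact main (n + 1) le_rfl
end

section
/- Let p be an odd prime and N₃(p) the number of 3-Diophantine triples in 𝔽_p (unordered sets {a,b,c} of distinct nonzero elements with abc+1 a square, where 0 is counted as a square). If p ≡ 1 (mod 3), writing p = a² + 3b² with a ≡ 2 (mod 3) and b > 0, then N₃(p) = (a+1)/3 + C(p−1,3)/2; if p ≡ 2 (mod 3), then N₃(p) = C(p−1,3)/2. -/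
/-- Uniqueness of the squares in the representation. -/
lemma rep_unique (p a b c d : ℤ) (hp : Prime p) (h1 : p = a^2+3*b^2) (h2 : p = c^2+3*d^2) :
    a^2 = c^2 := by
  have hp0 : p ≠ 0 := hp.ne_zero
  have key : ∀ d : ℤ, p = c^2+3*d^2 → p ∣ a*d-b*c → a^2 = c^2 := by
    intro d h2 hd
    obtain ⟨k, hk⟩ := hd
    have e : p^2 = (a*c+3*b*d)^2+3*(a*d-b*c)^2 := by
      calc p^2 = (a^2+3*b^2)*(c^2+3*d^2) := by rw [← h1, ← h2]; ring
        _ = _ := by ring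
    have hk0 : k = 0 := by
      by_contra hne
      have : 1 ≤ k^2 := by have := sq_pos_of_ne_zero hne; omega
      have hp2 : 0 < p^2 := by positivity
      rw [hk] at e
      nlinarith [sq_nonneg (a*c+3*b*d)]
    rw [hk0, mul_zero] at hk
    have e2 : p*(d^2-b^2) = 0 := by
      have : p*(d^2-b^2) = (a*d-b*c)*(a*d+b*c) := by
        calc p*(d^2-b^2) = p*d^2 - p*b^2 := by ring
          _ = (a^2+3*b^2)*d^2 - (c^2+3*d^2)*b^2 := by rw [← h1, ← h2]
          _ = _ := by ring
      rw [this, hk, zero_mul]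
    rcases mul_eq_zero.1 e2 with h | h
    · exact absurd h hp0
    · linarith
  have : p ∣ (a*d-b*c)*(a*d+b*c) := ⟨d^2-b^2, by
        symm
        calc p*(d^2-b^2) = p*d^2 - p*b^2 := by ring
          _ = (a^2+3*b^2)*d^2 - (c^2+3*d^2)*b^2 := by rw [← h1, ← h2]
          _ = _ := by ring⟩
  rcases hp.dvd_or_dvd this with h | h
  · exact key d h2 h
  · refine key (-d) (by rw [h2]; ring) ?_
    have e : a * -d - b * c = -(a * d + b * c) := by ring
    rw [e]
    exact (dvd_neg).2 h

open Finset in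
lemma newton3 {R : Type*} [CommRing R] {ι : Type*} [Fintype ι] [DecidableEq ι] (v : ι → R) :
    6 * ∑ S ∈ powersetCard 3 univ, ∏ i ∈ S, v i =
      (∑ i, v i)^3 - 3 * (∑ i, v i) * (∑ i, v i^2) + 2 * ∑ i, v i^3 := by
  have h3 := congrArg (MvPolynomial.aeval v) (MvPolynomial.mul_esymm_eq_sum ι ℤ 3)
  have h2 := congrArg (MvPolynomial.aeval v) (MvPolynomial.mul_esymm_eq_sum ι ℤ 2)
  have h1 := congrArg (MvPolynomial.aeval v) (MvPolynomial.mul_esymm_eq_sum ι ℤ 1)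
  have e3 : ({a ∈ antidiagonal 3 | a.1 < 3} : Finset (ℕ×ℕ)) = {(0,3),(1,2),(2,1)} := by decide
  have e2 : ({a ∈ antidiagonal 2 | a.1 < 2} : Finset (ℕ×ℕ)) = {(0,2),(1,1)} := by decide
  have e1 : ({a ∈ antidiagonal 1 | a.1 < 1} : Finset (ℕ×ℕ)) = {(0,1)} := by decide
  rw [e3] at h3
  rw [e2] at h2
  rw [e1] at h1
  simp [MvPolynomial.psum] at h1 h2 h3
  have e : (MvPolynomial.aeval v) (MvPolynomial.esymm ι ℤ 3) = ∑ S ∈ powersetCard 3 univ, ∏ i ∈ S, v i := by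
    simp [MvPolynomial.esymm]
  rw [← e]
  grind

open Finset in
lemma newton_f {M : Type*} [CommMonoid M] [Fintype M] [DecidableEq M] (f : M → ℤ) :
    6 * ∑ S ∈ powersetCard 3 (univ : Finset M), f (∏ i ∈ S, i) =
      (∑ x, ∑ y, ∑ z, f (x*y*z)) - 3 * (∑ x, ∑ y, f (x * y^2)) + 2 * ∑ x, f (x^3) := by
  have h := newton3 (fun x : M => (MonoidAlgebra.of ℤ M x))
  let L : MonoidAlgebra ℤ M →+ ℤ := MonoidAlgebra.liftNC (AddMonoidHom.id ℤ) f
  have hL : ∀ m, L (MonoidAlgebra.of ℤ M m) = f m := by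
    intro m; simp [L]
  have h' := congrArg L h
  have six : ∀ (n : ℕ) (z : MonoidAlgebra ℤ M), L ((n : MonoidAlgebra ℤ M) * z) = n * L z := by
    intro n z; rw [← nsmul_eq_mul, map_nsmul, nsmul_eq_mul]
  have s6 := six 6
  have s3 := six 3
  have s2 := six 2
  push_cast at s6 s3 s2
  rw [map_add, map_sub, mul_assoc, s6, s3, s2] at h'
  have hP : ∀ S : Finset M, L (∏ i ∈ S, MonoidAlgebra.of ℤ M i) = f (∏ i ∈ S, i) := by
    intro S; rw [← map_prod]; exact hL _
  simp only [hP, map_sum, hL, pow_succ, pow_zero, one_mul, sum_mul_sum, ← map_mul] at h'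
  simp only [sum_mul, mul_sum, map_sum, ← map_mul, hL] at h' ⊢
  simp only [pow_succ, pow_zero, one_mul]
  rw [h']
  congr 2
  exact sum_congr rfl fun x _ => sum_comm

open Finset

section
variable {p : ℕ} [Fact p.Prime]

local notation "χ" => quadraticChar (ZMod p)

lemma chi_corr (h2 : p ≠ 2) (u v : ZMod p) :
    ∑ c : ZMod p, χ (c + u) * χ (c + v) = if u = v then (p : ℤ) - 1 else -1 := by
  have hF : ringChar (ZMod p) ≠ 2 := by rwa [ZMod.ringChar_zmod_n]
  split_ifs with h
  · subst h
    rw [Fintype.sum_equiv (Equiv.addRight u) (fun c => χ (c+u) * χ (c+u)) (fun c => χ c * χ c) (fun _ => rfl)]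
    have : ∀ c : ZMod p, χ c * χ c = 1 - if c = 0 then 1 else 0 := by
      intro c
      split_ifs with hc
      · simp [hc]
      · rw [← sq, quadraticChar_sq_one hc]; simp
    simp only [this]
    simp [ZMod.card]
  · have hw : v - u ≠ 0 := sub_ne_zero.2 (Ne.symm h)
    have hJ := jacobiSum_nontrivial_inv (quadraticChar_ne_one hF)
    rw [(quadraticChar_isQuadratic _).inv, jacobiSum] at hJ
    have e : ∑ c : ZMod p, χ (c + u) * χ (c + v) = ∑ x : ZMod p, χ (-1) * (χ x * χ (1 - x)) := by
      symm
      refine Fintype.sum_equiv ((Equiv.mulLeft₀ (-(v-u)) (neg_ne_zero.2 hw)).trans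
        (Equiv.subRight u)) _ _ ?_
      intro x
      simp only [Equiv.trans_apply, Equiv.mulLeft₀_apply, Equiv.subRight_apply]
      have e1 : -(v-u) * x - u + u = (-1) * ((v-u) * x) := by ring
      have e2 : -(v-u) * x - u + v = (v-u) * (1-x) := by ring
      rw [e1, e2]
      simp only [map_mul]
      have := quadraticChar_sq_one hw
      linear_combination (-(χ (-1)) * χ x * χ (1-x)) * this
    rw [e, ← mul_sum, hJ]
    have := quadraticChar_sq_one (F := ZMod p) (neg_ne_zero.2 one_ne_zero)
    linarith [sq (χ (-1))]

lemma sum_units_pow (f : ZMod p → ℤ) (g : (ZMod p)ˣ) (hg : ∀ x, x ∈ Subgroup.zpowers g) :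
    ∑ x : ZMod p, f x = f 0 + ∑ i ∈ range (p-1), f ((g:ZMod p)^i) := by
  have h0 : ∑ x : ZMod p, f x = f 0 + ∑ x ∈ univ.erase (0:ZMod p), f x := by
    rw [add_sum_erase _ _ (mem_univ _)]
  rw [h0]
  congr 1
  have ho : orderOf g = p - 1 := by
    rw [orderOf_eq_card_of_forall_mem_zpowers hg, Nat.card_eq_fintype_card, ZMod.card_units]
  symm
  refine sum_bij (fun i _ => (g:ZMod p)^i) ?_ ?_ ?_ ?_
  · intro i _; simp
  · intro i hi j hj hij
    rw [← ho] at hi hj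
    simp only [coe_range, Set.mem_Iio, mem_range] at hi hj
    refine pow_injOn_Iio_orderOf hi hj ?_
    apply Units.ext
    simpa using hij
  · intro b hb
    have hb0 : b ≠ 0 := by simpa using hb
    have := hg (Units.mk0 b hb0)
    rw [← mem_powers_iff_mem_zpowers, mem_powers_iff_mem_range_orderOf, ho] at this
    simp only [mem_image] at this
    obtain ⟨i, hi, h⟩ := this
    refine ⟨i, hi, ?_⟩
    have := congrArg Units.val h
    simpa using this
  · intro _ _; rfl

/-- For p ≡ 1 mod 3 there is a primitive cube root of unity. -/
lemma exists_omega (h1 : p % 3 = 1) : ∃ w : ZMod p, w^2 + w + 1 = 0 ∧ w ≠ 1 ∧ w ≠ 0 := by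
  have : Fact (Nat.Prime 3) := ⟨Nat.prime_three⟩
  obtain ⟨w, hw⟩ := exists_prime_orderOf_dvd_card (G := (ZMod p)ˣ) 3 (by
    rw [ZMod.card_units]; omega)
  have hw1 : (w : ZMod p) ≠ 1 := by
    intro h
    have : w = 1 := Units.ext h
    rw [this] at hw; simp at hw
  refine ⟨w, ?_, hw1, w.ne_zero⟩
  have h3 : (w : ZMod p)^3 = 1 := by
    have := pow_orderOf_eq_one w
    rw [hw] at this
    have h := congrArg Units.val this
    simpa using h
  have : ((w : ZMod p) - 1) * ((w:ZMod p)^2 + w + 1) = 0 := by linear_combination h3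
  rcases mul_eq_zero.1 this with h | h
  · exact absurd (sub_eq_zero.1 h) hw1
  · exact h

lemma card_cube (h1 : p % 3 = 1) (y : ZMod p) (hy : y ≠ 0) :
    #{x : ZMod p | x^3 = y^3} = 3 := by
  obtain ⟨w, hw, hw1, hw0⟩ := exists_omega h1
  have : ({x : ZMod p | x^3 = y^3} : Finset _) = {y, w*y, w^2*y} := by
    ext x
    simp only [mem_filter, mem_univ, true_and, mem_insert, mem_singleton]
    constructor
    · intro h
      have : (x-y)*((x-w*y)*(x-w^2*y)) = 0 := by
        linear_combination h + (-x^2*y + x*y^2*(w) - (w-1)*y^3) * hw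
      rcases mul_eq_zero.1 this with h | h
      · left; exact sub_eq_zero.1 h
      rcases mul_eq_zero.1 h with h | h
      · right; left; exact sub_eq_zero.1 h
      · right; right; exact sub_eq_zero.1 h
    · have h3 : w^3 = 1 := by linear_combination (w-1)*hw
      rintro (h | h | h) <;> subst h
      · rfl
      · linear_combination y^3 * h3
      · linear_combination y^3 * (w^3+1) * h3
  rw [this, card_eq_three]
  refine ⟨_, _, _, ?_, ?_, ?_, rfl⟩
  · intro h
    exact hw1 (mul_right_cancel₀ hy (by linear_combination -h))
  · intro h
    have : w = -2 := by
      have := mul_right_cancel₀ hy (show (1:ZMod p) * y = w^2 * y by linear_combination h)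
      linear_combination hw + this
    have h' := mul_right_cancel₀ hy (show (1:ZMod p) * y = w^2 * y by linear_combination h)
    have h3 : w^3 = 1 := by linear_combination (w-1)*hw
    exact hw1 (by linear_combination h3 + w * h')
  · intro h
    have h' := mul_right_cancel₀ hy h
    exact hw1 (mul_right_cancel₀ hw0 (by linear_combination -h'))

lemma sum_periodic (f : ℕ → ℤ) (hf : ∀ i, f (i+3) = f i) (m : ℕ) :
    ∑ i ∈ range (3*m), f i = m * (f 0 + f 1 + f 2) := by
  have hf' : ∀ m r, f (3*m+r) = f r := by
    intro m r
    induction m with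
    | zero => simp
    | succ n ih => rw [← ih, ← hf (3*n+r)]; congr 1; ring
  induction m with
  | zero => simp
  | succ n ih =>
    rw [show 3*(n+1) = 3*n+1+1+1 by ring, sum_range_succ, sum_range_succ, sum_range_succ, ih]
    have a0 := hf' n 0
    have a1 := hf' n 1
    have a2 := hf' n 2
    simp only [add_zero, add_assoc, Nat.reduceAdd] at a0 a1 a2 ⊢
    rw [a0, a1, a2]; push_cast; ring

/-- The character sum. -/
lemma charsum (h2 : p ≠ 2) (h1 : p % 3 = 1) (a b : ℤ) (ha : a % 3 = 2)
    (hab : (p:ℤ) = a^2 + 3*b^2) : ∑ x : ZMod p, χ (x^3+1) = 2 * a := by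
  have hp : p.Prime := Fact.out
  have hF : ringChar (ZMod p) ≠ 2 := by rwa [ZMod.ringChar_zmod_n]
  obtain ⟨g, hg⟩ := IsCyclic.exists_generator (α := (ZMod p)ˣ)
  obtain ⟨m, hm⟩ : ∃ m, p - 1 = 3 * m := ⟨(p-1)/3, by omega⟩
  have hm0 : (m:ℤ) ≠ 0 := by
    have := hp.two_le
    have : m ≠ 0 := by rintro rfl; omega
    exact_mod_cast this
  have hpm : (p:ℤ) = 3*m+1 := by have := hp.two_le; omega
  let U : ZMod p → ℤ := fun c => ∑ x : ZMod p, χ (c+0) * χ (c + x^3)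
  have hg0 : (g : ZMod p) ≠ 0 := g.ne_zero
  have hUd : ∀ c d : ZMod p, d ≠ 0 → U (c * d^3) = U c := by
    intro c d hd
    symm
    refine Fintype.sum_equiv (Equiv.mulLeft₀ d hd) _ _ ?_
    intro x
    simp only [Equiv.mulLeft₀_apply]
    have e : c * d^3 + (d*x)^3 = (c + x^3) * d^3 := by ring
    rw [e]
    simp only [add_zero, map_mul, map_pow]
    have := quadraticChar_sq_one hd
    have h6 : (χ d)^6 = 1 := by rw [show 6 = 2*3 by rfl, pow_mul, this]; norm_num
    linear_combination (-(χ c) * χ (c+x^3)) * h6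
  have hper : ∀ i, U ((g:ZMod p)^(i+3)) = U ((g:ZMod p)^i) := by
    intro i; rw [pow_add]; exact hUd _ _ hg0
  have hU0 : U 0 = 0 := by simp [U]
  -- first moment
  have hS1 : ∑ c, U c = 0 := by
    simp only [U]
    rw [sum_comm]
    simp only [chi_corr h2]
    have : ∀ x : ZMod p, (if 0 = x^3 then (p:ℤ)-1 else -1) = (if x = 0 then (p:ℤ) else 0) - 1 := by
      intro x
      by_cases hx : x = 0
      · simp [hx]
      · have : (0 : ZMod p) ≠ x^3 := (pow_ne_zero 3 hx).symm
        simp [hx, this]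
    simp [this, ZMod.card]
  -- second moment
  have hS2 : ∑ c, (U c)^2 = 2 * p * (p - 1) := by
    have hT0 : ∑ x : ZMod p, χ (0 + x^3) = 0 := by
      rw [← quadraticChar_sum_zero hF]
      refine sum_congr rfl fun x _ => ?_
      by_cases hx : x = 0
      · simp [hx]
      · rw [zero_add, map_pow, pow_succ, quadraticChar_sq_one hx, one_mul]
    have e1 : ∀ c, (U c)^2 = ∑ x : ZMod p, ∑ y : ZMod p, χ (c + x^3) * χ (c + y^3) := by
      intro c
      rw [← sum_mul_sum, ← sq]
      by_cases hc : c = 0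
      · rw [hc, hT0, hU0]
      · simp only [U]
        rw [← mul_sum, mul_pow, add_zero, quadraticChar_sq_one hc, one_mul]
    simp only [e1]
    rw [sum_comm]
    have e2 : ∀ x : ZMod p, ∑ c : ZMod p, ∑ y : ZMod p, χ (c + x^3) * χ (c + y^3)
        = (if x = 0 then -2 * (p:ℤ) else 0) + 2 * p := by
      intro x
      rw [sum_comm]
      simp only [chi_corr h2]
      have : ∀ y : ZMod p, (if x^3 = y^3 then (p:ℤ)-1 else -1)
          = p * (if y^3 = x^3 then 1 else 0) - 1 := by
        intro y
        by_cases h : y^3 = x^3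
        · simp [h]
        · simp [h, Ne.symm h]
      simp only [this]
      rw [sum_sub_distrib, ← mul_sum, sum_boole]
      by_cases hx : x = 0
      · simp [hx, ZMod.card, filter_eq']
        try ring
      · rw [card_cube h1 x hx]
        simp [hx, ZMod.card]
        ring
    simp only [e2, sum_add_distrib]
    simp [ZMod.card]
    ring
  rw [sum_units_pow _ g hg, hm, sum_periodic _ hper, hU0, zero_add] at hS1
  rw [sum_units_pow _ g hg, hm, sum_periodic (fun i => (U ((g:ZMod p)^i))^2)
    (fun i => by simp only [hper]), hU0] at hS2
  simp only [pow_zero, pow_one] at hS1 hS2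
  have hE : ∑ x : ZMod p, χ (x^3+1) = U 1 := by
    simp only [U]
    refine sum_congr rfl fun x _ => ?_
    simp [add_comm]
  have hs1 : U 1 + U g + U (g^2) = 0 := (mul_eq_zero.1 hS1).resolve_left hm0
  have hs2 : (U 1)^2 + (U g)^2 + (U (g^2))^2 = 6 * p := by
    apply mul_left_cancel₀ hm0
    have : (p:ℤ) - 1 = 3 * m := by linarith
    rw [this] at hS2
    linarith
  -- parity
  have hpar : (2:ℤ) ∣ U 1 := by
    rw [← hE]
    have : ∀ v : ZMod p, (2:ℤ) ∣ χ v - (1 - if v = 0 then 1 else 0) := by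
      intro v
      by_cases hv : v = 0
      · simp [hv]
      · rcases quadraticChar_dichotomy hv with h | h <;> simp [h, hv]
    have hd := dvd_sum (s := (univ : Finset (ZMod p))) (fun x _ => this (x^3+1))
    rw [sum_sub_distrib, sum_sub_distrib, sum_boole] at hd
    have hc : ({x : ZMod p | x^3 + 1 = 0} : Finset (ZMod p)) = ({x : ZMod p | x^3 = (-1)^3} : Finset (ZMod p)) := by
      ext x
      simp only [mem_filter, mem_univ, true_and]
      constructor <;> intro h <;> linear_combination h
    rw [hc, card_cube h1 (-1) (by simp)] at hd
    simp [ZMod.card, -quadraticChar_apply] at hd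
    have := hp.eq_two_or_odd
    omega
  -- mod 3
  have hmod : (3:ℤ) ∣ U 1 - 1 := by
    rw [← hE, sum_units_pow _ g hg, hm, show 3*m = m+m+m by ring, sum_range_add, sum_range_add]
    have hg3 : ((g:ZMod p)^m)^3 = 1 := by
      rw [← pow_mul, mul_comm, ← hm]; exact ZMod.pow_card_sub_one_eq_one hg0
    have ex1 : ∀ x, ((g:ZMod p)^(m+x))^3 = ((g:ZMod p)^x)^3 := by
      intro x; rw [pow_add, mul_pow, hg3, one_mul]
    have ex2 : ∀ x, ((g:ZMod p)^(m+m+x))^3 = ((g:ZMod p)^x)^3 := by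
      intro x; rw [add_assoc, ex1, ex1]
    simp only [ex1, ex2]
    refine ⟨∑ i ∈ range m, χ (((g:ZMod p)^i)^3 + 1), ?_⟩
    simp
    ring
  obtain ⟨a', ha'⟩ := hpar
  have h3 : 3 * a'^2 + (U g + a')^2 = 3 * p := by
    have e : U (g^2) = - U 1 - U g := by linarith
    rw [e, ha'] at hs2
    linarith
  have h3d : (3:ℤ) ∣ U g + a' := by
    apply Int.prime_three.dvd_of_dvd_pow (n := 2)
    exact ⟨p - a'^2, by linarith⟩
  obtain ⟨b', hb'⟩ := h3d
  rw [hb'] at h3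
  have hsq := rep_unique p a b a' b' (Nat.prime_iff_prime_int.1 hp) hab (by linarith)
  rw [hE, ha']
  rcases sq_eq_sq_iff_eq_or_eq_neg.1 hsq with h | h
  · rw [h]
  · omega

lemma sum_mul_left' (f : ZMod p → ℤ) (h0 : f 0 = 0) (u : ZMod p) :
    ∑ z, f (u * z) = if u = 0 then 0 else ∑ z, f z := by
  split_ifs with h
  · simp [h, h0]
  · exact Fintype.sum_equiv (Equiv.mulLeft₀ u h) _ _ (fun _ => rfl)

lemma sum_ite_nz (s : ℤ) : ∑ x : ZMod p, (if x = 0 then 0 else s) = (p - 1) * s := by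
  have : ∀ x : ZMod p, (if x = 0 then 0 else s) = s - if x = 0 then s else 0 := by
    intro x; split_ifs <;> simp
  simp only [this, sum_sub_distrib]
  simp [ZMod.card]
  ring

lemma main_count (h2 : p ≠ 2) :
    12 * (Nat.card {S : Finset (ZMod p) // S.card = 3 ∧ (0 : ZMod p) ∉ S ∧
          IsSquare (S.prod id + 1)} : ℤ) = (p-1)*(p-2)*(p-3) +
      2 * (∑ x : ZMod p, χ (x^3+1) - 1 + #{x : ZMod p | x^3 + 1 = 0}) := by
  have hF : ringChar (ZMod p) ≠ 2 := by rwa [ZMod.ringChar_zmod_n]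
  classical
  let f : ZMod p → ℤ := fun t => (1 + χ (t+1) + if t+1 = 0 then 1 else 0) - if t = 0 then 2 else 0
  have f0 : f 0 = 0 := by simp [f]
  have fs : ∀ t, t ≠ 0 → f t = if IsSquare (t+1) then 2 else 0 := by
    intro t ht
    simp only [f, ht, if_false, sub_zero]
    by_cases h : t + 1 = 0
    · simp [h]
    · by_cases hs : IsSquare (t+1)
      · rw [(quadraticChar_one_iff_isSquare h).2 hs]; simp [h, hs]
      · rw [quadraticChar_neg_one_iff_not_isSquare.2 hs]; simp [h, hs]
  have hN : 2 * (Nat.card {S : Finset (ZMod p) // S.card = 3 ∧ (0 : ZMod p) ∉ S ∧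
          IsSquare (S.prod id + 1)} : ℤ) =
      ∑ S ∈ powersetCard 3 (univ : Finset (ZMod p)), f (∏ i ∈ S, i) := by
    have e : ∀ S ∈ powersetCard 3 (univ : Finset (ZMod p)), f (∏ i ∈ S, i) =
        2 * if ((0 : ZMod p) ∉ S ∧ IsSquare (S.prod id + 1)) then 1 else 0 := by
      intro S _
      by_cases h : (0 : ZMod p) ∈ S
      · rw [prod_eq_zero h rfl, f0]; simp [h]
      · have : ∏ i ∈ S, i ≠ 0 := by
          rw [prod_ne_zero_iff]; rintro a ha rfl; exact h ha
        rw [fs _ this]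
        simp [h]
    rw [sum_congr rfl e, ← mul_sum, sum_boole, Nat.card_eq_fintype_card, Fintype.card_subtype]
    congr 3
    ext S
    simp
  have hs : ∑ t, f t = p - 1 := by
    simp only [f, sum_sub_distrib, sum_add_distrib]
    rw [Fintype.sum_equiv (Equiv.addRight (1:ZMod p)) (fun c => χ (c+1)) (fun c => χ c)
      (fun _ => rfl), quadraticChar_sum_zero hF]
    simp [ZMod.card, add_eq_zero_iff_eq_neg]
    ring
  have hc : ∑ t, f (t^3) = p - 1 + (∑ x : ZMod p, χ (x^3+1) - 1 + #{x : ZMod p | x^3 + 1 = 0}) := by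
    simp only [f, sum_sub_distrib, sum_add_distrib]
    rw [sum_boole]
    simp [ZMod.card]
    ring
  have hN' := newton_f f
  rw [← hN, hc] at hN'
  have e1 : ∑ x, ∑ y, f (x * y^2) = (p-1) * (p-1) := by
    rw [sum_comm]
    simp only [mul_comm _ (_^2), sum_mul_left' f f0, hs, pow_eq_zero_iff two_ne_zero]
    rw [sum_ite_nz]
  have e2 : ∑ x, ∑ y, ∑ z, f (x * y * z) = (p-1) * ((p-1) * (p-1)) := by
    simp only [sum_mul_left' f f0, hs]
    rw [← sum_ite_nz]
    refine sum_congr rfl fun x _ => ?_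
    split_ifs with h
    · simp [h]
    · simp only [mul_eq_zero, h, false_or]
      rw [sum_ite_nz]
  rw [e1, e2] at hN'
  linear_combination hN'

lemma bij_case (h2 : p ≠ 2) (h : p % 3 = 2) :
    ∑ x : ZMod p, χ (x^3+1) = 0 ∧ #{x : ZMod p | x^3 + 1 = 0} = 1 := by
  have hF : ringChar (ZMod p) ≠ 2 := by rwa [ZMod.ringChar_zmod_n]
  have hinv : ∀ x : ZMod p, (x^3)^(2*(p/3)+1) = x := by
    intro x
    by_cases hx : x = 0
    · simp [hx]
    · rw [← pow_mul, show 3*(2*(p/3)+1) = (p-1)*2+1 by omega, pow_succ, pow_mul,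
        ZMod.pow_card_sub_one_eq_one hx]
      simp
  have hinj : Function.Injective (fun x : ZMod p => x^3) :=
    Function.LeftInverse.injective (g := fun y => y^(2*(p/3)+1)) hinv
  constructor
  · rw [Fintype.sum_equiv ((Equiv.ofBijective _ (Finite.injective_iff_bijective.1 hinj)).trans
      (Equiv.addRight 1)) (fun x : ZMod p => χ (x^3+1)) (fun c => χ c) (fun _ => rfl)]
    exact quadraticChar_sum_zero hF
  · rw [card_eq_one]
    refine ⟨-1, ?_⟩
    ext x
    simp only [mem_filter, mem_univ, true_and, mem_singleton]
    constructor
    · intro hx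
      apply hinj
      change x^3 = (-1)^3
      linear_combination hx
    · rintro rfl; ring

end

lemma choose_three_cast (q : ℕ) : 6 * (q.choose 3 : ℚ) = q * (q-1) * (q-2) := by
  induction q with
  | zero => simp
  | succ n ih =>
    rw [Nat.choose_succ_succ' n 2]
    push_cast
    rw [Nat.cast_choose_two]
    linear_combination ih

theorem num_3_diophantine_triples (p : ℕ) (hp : p.Prime) (hodd : Odd p) :
    (∀ a b : ℤ, a % 3 = 2 → 0 < b → (p : ℤ) = a ^ 2 + 3 * b ^ 2 →
      (Nat.card {S : Finset (ZMod p) // S.card = 3 ∧ (0 : ZMod p) ∉ S ∧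
          IsSquare (S.prod id + 1)} : ℚ) = (a + 1) / 3 + ((p - 1).choose 3 : ℚ) / 2) ∧
    (p % 3 = 2 →
      (Nat.card {S : Finset (ZMod p) // S.card = 3 ∧ (0 : ZMod p) ∉ S ∧
          IsSquare (S.prod id + 1)} : ℚ) = ((p - 1).choose 3 : ℚ) / 2) := by
  have : Fact p.Prime := ⟨hp⟩
  have h2 : p ≠ 2 := by rintro rfl; exact absurd hodd (by decide)
  have hC := choose_three_cast (p-1)
  rw [Nat.cast_sub hp.one_le] at hC
  push_cast at hC
  have hM := main_count (p := p) h2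
  constructor
  · intro a b ha _ hab
    have h1 : p % 3 = 1 := by
      have : a^2 % 3 = 1 := by rw [sq, Int.mul_emod, ha]; rfl
      omega
    rw [charsum h2 h1 a b ha hab] at hM
    have hc : ({x : ZMod p | x^3 + 1 = 0} : Finset (ZMod p)) =
        ({x : ZMod p | x^3 = (-1)^3} : Finset (ZMod p)) := by
      ext x
      simp only [mem_filter, mem_univ, true_and]
      constructor <;> intro h <;> linear_combination h
    rw [hc, card_cube h1 (-1) (by simp)] at hM
    have hQ := congrArg (Int.cast : ℤ → ℚ) hM
    push_cast at hQ
    linear_combination hQ / 12 - hC / 12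
  · intro h
    obtain ⟨e1, e2⟩ := bij_case h2 h
    rw [e1, e2] at hM
    have hQ := congrArg (Int.cast : ℤ → ℚ) hM
    push_cast at hQ
    linear_combination hQ / 12 - hC / 12
end
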